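/- arXiv:2206.06492 — 2 statements merged into one kernel-verified Lean document; each statement's English description precedes it below -/
import Mathlib

section
/- Let c : 𝕏 × 𝔸 → [−∞, +∞] be lower semianalytic and real-valued on Γ (extended by +∞ off Γ), and let ψ : [−∞, +∞] → [0, +∞] be strictly increasing, nonnegative and continuous, with ψ^{-1} extended to a non-decreasing function on [−∞, +∞]. Then the functions φ(p) := limsup_{n→∞} n^{-1} ψ^{-1}(∫_Ω ψ(Σ_{k=0}^{n-1} c(x_k, a_k)) p(dω)) and φ̂(p) := limsup_{n→∞} sup_{j≥0} n^{-1} ψ^{-1}(∫_Ω ψ(Σ_{k=0}^{n-1} c(x_{j+k}, a_{j+k})) p(dω)) are lower semianalytic on P(Ω). -/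
open MeasureTheory ProbabilityTheory Filter
open scoped ENNReal NNReal Topology

noncomputable section

namespace PaperStmt

/-- The Borel σ-algebra of the topology of weak convergence on the space of Borel
probability measures. -/
instance instMeasProb {Ω : Type*} [MeasurableSpace Ω] [TopologicalSpace Ω]
    [OpensMeasurableSpace Ω] : MeasurableSpace (ProbabilityMeasure Ω) := borel _

/-- A set is universally measurable if it is measurable with respect to the completion of
every Borel probability measure. -/
def UniversallyMeasurableSet {α : Type*} [MeasurableSpace α] (s : Set α) : Prop :=
  ∀ μ : Measure α, IsProbabilityMeasure μ → NullMeasurableSet s μ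

/-- A map between measurable spaces is universally measurable if preimages of measurable
sets are universally measurable. -/
def UniversallyMeasurable {α β : Type*} [MeasurableSpace α] [MeasurableSpace β]
    (f : α → β) : Prop :=
  ∀ s : Set β, MeasurableSet s → UniversallyMeasurableSet (f ⁻¹' s)

/-- A function into the extended reals is lower semianalytic if all its sublevel sets are
analytic. -/
def LowerSemianalytic {γ : Type*} [TopologicalSpace γ] (f : γ → EReal) : Prop :=
  ∀ r : ℝ, MeasureTheory.AnalyticSet {x | f x ≤ (r : EReal)}

/-- Lower semianalyticity on a given (analytic) domain. -/
def LowerSemianalyticOn {γ : Type*} [TopologicalSpace γ] (D : Set γ) (f : γ → EReal) : Prop :=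
  ∀ r : ℝ, MeasureTheory.AnalyticSet {x | x ∈ D ∧ f x ≤ (r : EReal)}

/-- Upper semianalyticity on a given (analytic) domain. -/
def UpperSemianalyticOn {γ : Type*} [TopologicalSpace γ] (D : Set γ) (f : γ → EReal) : Prop :=
  ∀ r : ℝ, MeasureTheory.AnalyticSet {x | x ∈ D ∧ (r : EReal) ≤ f x}

/-- The nonnegative part of an extended real number, as an element of `ℝ≥0∞`. -/
def ePos (y : EReal) : ℝ≥0∞ := if y = ⊤ then ⊤ else ENNReal.ofReal y.toReal

/-- The integral `∫ f⁺ dμ - ∫ f⁻ dμ` of an extended-real-valued function, with the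
convention `∞ - ∞ = ∞`. -/
def eint {γ : Type*} [MeasurableSpace γ] (μ : Measure γ) (f : γ → EReal) : EReal :=
  if (∫⁻ x, ePos (f x) ∂μ) = ⊤ then ⊤
  else ((∫⁻ x, ePos (f x) ∂μ : ℝ≥0∞) : EReal) - ((∫⁻ x, ePos (-f x) ∂μ : ℝ≥0∞) : EReal)

/-- Finite sums of extended reals, with the convention `∞ - ∞ = ∞`. -/
def esum {n : ℕ} (v : Fin n → EReal) : EReal :=
  if (∑ i, ePos (v i)) = ⊤ then ⊤
  else ((∑ i, ePos (v i) : ℝ≥0∞) : EReal) - ((∑ i, ePos (-v i) : ℝ≥0∞) : EReal)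

/-- The space `H_n = (𝕏 × 𝔸)ⁿ × 𝕏` of histories `h_n = (x_0,a_0,…,x_n)`. -/
abbrev Hist (X A : Type*) (n : ℕ) := (Fin n → X × A) × X

/-- The sample space `Ω = (𝕏 × 𝔸)^∞`. -/
abbrev Traj (X A : Type*) := ℕ → X × A

/-- The initial state `x_0` of a history. -/
def firstState {X A : Type*} : ∀ {n : ℕ}, Hist X A n → X
  | 0, h => h.2
  | _ + 1, h => (h.1 0).1

/-- A universally measurable policy for the MDP with control constraint `Acts`. -/
structure Policy {X A : Type*} [MeasurableSpace X] [MeasurableSpace A]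
    (Acts : X → Set A) where
  μ : ∀ n : ℕ, Hist X A n → Measure A
  isProb : ∀ n h, IsProbabilityMeasure (μ n h)
  umeas : ∀ (n : ℕ) (B : Set A), MeasurableSet B →
    UniversallyMeasurable fun h : Hist X A n => μ n h B
  feasible : ∀ n h, μ n h (Acts h.2) = 1

namespace Policy

variable {X A : Type*} [MeasurableSpace X] [MeasurableSpace A] {Acts : X → Set A}

/-- Nonrandomized policies: every decision is a Dirac measure. -/
def Nonrandomized (π : Policy Acts) : Prop :=
  ∀ n h, ∃ a : A, π.μ n h = Measure.dirac a

/-- Markov policies: the decision depends only on the current state. -/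
def Markov (π : Policy Acts) : Prop :=
  ∃ m : ℕ → X → Measure A, ∀ n h, π.μ n h = m n h.2

/-- Stationary policies. -/
def Stationary (π : Policy Acts) : Prop :=
  ∃ m : X → Measure A, ∀ n h, π.μ n h = m h.2

/-- Semi-Markov policies: the decision depends only on `(x_0, x_n)`. -/
def SemiMarkov (π : Policy Acts) : Prop :=
  ∃ m : ℕ → X × X → Measure A, ∀ n h, π.μ n h = m n (firstState h, h.2)

/-- Semi-stationary policies. -/
def SemiStationary (π : Policy Acts) : Prop :=
  ∃ m : X × X → Measure A, ∀ n h, π.μ n h = m (firstState h, h.2)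

end Policy

variable {X A : Type*} [MeasurableSpace X] [MeasurableSpace A]

/-- The iterated integral giving the finite-dimensional distributions of the process
induced by an initial distribution, the transition kernel and a policy. -/
def histInt (p0 : Measure X) (q : Kernel (X × A) X)
    (ν : ∀ n : ℕ, Hist X A n → Measure A) :
    ∀ n : ℕ, (Hist X A n → ℝ≥0∞) → ℝ≥0∞
  | 0, f => ∫⁻ x, f (Fin.elim0, x) ∂p0
  | n + 1, f => histInt p0 q ν n fun h =>
      ∫⁻ a, ∫⁻ y, f (Fin.snoc h.1 (h.2, a), y) ∂(q (h.2, a)) ∂(ν n h)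

/-- `Induces q π p0 p` says that `p` is (the restriction to the Borel σ-algebra of) the
strategic measure `ρ_{p0}[π]`, i.e. `p` has the finite-dimensional distributions generated
by `p0`, the policy `π`, and the transition kernel `q`. -/
def Induces (q : Kernel (X × A) X) {Acts : X → Set A} (π : Policy Acts)
    (p0 : Measure X) (p : Measure (Traj X A)) : Prop :=
  ∀ (n : ℕ) (B : Set (Hist X A n)), MeasurableSet B →
    p {ω : Traj X A | ((fun i : Fin n => ω i.val), (ω n).1) ∈ B}
      = histInt p0 q π.μ n (B.indicator fun _ => 1)

/-- The set of strategic measures induced by policies in the class `C` (over all initial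
distributions). -/
def SOf (q : Kernel (X × A) X) (Acts : X → Set A) (C : Policy Acts → Prop) :
    Set (ProbabilityMeasure (Traj X A)) :=
  {p | ∃ (π : Policy Acts) (p0 : ProbabilityMeasure X),
    C π ∧ Induces q π p0.toMeasure p.toMeasure}

variable [TopologicalSpace X] [BorelSpace X] [TopologicalSpace A] [BorelSpace A]

/-- The section `tilde-S_⋆(x)`: strategic measures in the class with initial distribution `δ_x`. -/
def tsec (q : Kernel (X × A) X) (Acts : X → Set A) (C : Policy Acts → Prop) (x : X) :
    Set (ProbabilityMeasure (Traj X A)) :=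
  {p | p ∈ SOf q Acts C ∧ p.toMeasure.map (fun ω => (ω 0).1) = Measure.dirac x}

/-- The set `tilde-S_⋆ ⊂ 𝕏 × P(Ω)`. -/
def tset (q : Kernel (X × A) X) (Acts : X → Set A) (C : Policy Acts → Prop) :
    Set (X × ProbabilityMeasure (Traj X A)) :=
  {xp | xp.2 ∈ tsec q Acts C xp.1}

end PaperStmt

namespace PaperStmt

variable {X A : Type*} [MeasurableSpace X] [MeasurableSpace A]

/-- The partial sum `Σ_{k=0}^{n-1} c(x_{k+j}, a_{k+j})` along a sample path, with the
convention `∞ - ∞ = ∞`. -/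
def pathSum (c : X × A → EReal) (n j : ℕ) (ω : Traj X A) : EReal :=
  esum fun k : Fin n => c (ω (k.val + j))

/-- Division by `n` in the extended reals. -/
def avg (n : ℕ) (y : EReal) : EReal := (((n : ℝ)⁻¹ : ℝ) : EReal) * y

/-- The risk functional `J_ψ`: `limsup_n n⁻¹ ψ⁻¹(E[ψ(Σ_{k<n} c(x_k,a_k))])`. -/
def Jpsi (c : X × A → EReal) (ψ : EReal → ℝ≥0∞) (ψinv : ℝ≥0∞ → EReal)
    (p : ProbabilityMeasure (Traj X A)) : EReal :=
  limsup (fun n : ℕ => avg n (ψinv (∫⁻ ω, ψ (pathSum c n 0 ω) ∂p.toMeasure))) atTop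

/-- The risk functional `Ĵ_ψ`: `limsup_n sup_{j≥0} n⁻¹ ψ⁻¹(E[ψ(Σ_{k<n} c(x_{j+k},a_{j+k}))])`. -/
def JpsiHat (c : X × A → EReal) (ψ : EReal → ℝ≥0∞) (ψinv : ℝ≥0∞ → EReal)
    (p : ProbabilityMeasure (Traj X A)) : EReal :=
  limsup (fun n : ℕ => ⨆ j : ℕ, avg n (ψinv (∫⁻ ω, ψ (pathSum c n j ω) ∂p.toMeasure))) atTop

/-- The pathwise average cost `c̄(ω) = limsup_n n⁻¹ Σ_{k<n} c(x_k,a_k)`. -/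
def cbar (c : X × A → EReal) (ω : Traj X A) : EReal :=
  limsup (fun n : ℕ => avg n (pathSum c n 0 ω)) atTop

/-- The `CVaR_α` functional of the pathwise average cost. -/
def Rcvar (c : X × A → EReal) (α : ℝ) (p : ProbabilityMeasure (Traj X A)) : EReal :=
  ⨅ z : ℝ, ((z : EReal) +
    (((ENNReal.ofReal α)⁻¹ * ∫⁻ ω, ePos (cbar c ω - (z : EReal)) ∂p.toMeasure : ℝ≥0∞) : EReal))

/-- The `VaR_α` functional of the pathwise average cost. -/
def Rvar (c : X × A → EReal) (α : ℝ) (p : ProbabilityMeasure (Traj X A)) : EReal :=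
  ⨅ (z : ℝ) (_ : 1 - ENNReal.ofReal α ≤ p.toMeasure {ω | cbar c ω ≤ (z : EReal)}), (z : EReal)

end PaperStmt

namespace PaperStmt

section Analytic

open Set TopologicalSpace Topology

/-- The points of the Baire space bounded by `σ` in their first `m` coordinates. -/
def boundedPrefix (σ : ℕ → ℕ) (m : ℕ) : Set (ℕ → ℕ) := {x | ∀ i < m, x i ≤ σ i}

lemma boundedPrefix_antitone (σ : ℕ → ℕ) : Antitone (boundedPrefix σ) :=
  fun _ _ h _ hx i hi => hx i (hi.trans_le h)

lemma Iic_subset_boundedPrefix (σ : ℕ → ℕ) (m : ℕ) : Iic σ ⊆ boundedPrefix σ m :=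
  fun _ hx i _ => hx i

lemma isCompact_Iic_nat_nat (σ : ℕ → ℕ) : IsCompact (Iic σ) := by
  rw [← Set.pi_univ_Iic]
  exact isCompact_univ_pi fun i => (Set.finite_Iic (σ i)).isCompact

lemma isOpen_cylinder_subset (V : Set (ℕ → ℕ)) (m : ℕ) :
    IsOpen {y | PiNat.cylinder y m ⊆ V} := by
  rw [isOpen_iff_mem_nhds]
  intro y hy
  refine Filter.mem_of_superset
    ((PiNat.isOpen_cylinder (fun _ => ℕ) y m).mem_nhds (PiNat.self_mem_cylinder y m)) ?_
  intro z hz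
  simpa [PiNat.mem_cylinder_iff_eq.1 hz] using hy

lemma exists_boundedPrefix_subset {σ : ℕ → ℕ} {V : Set (ℕ → ℕ)} (hV : IsOpen V)
    (h : Iic σ ⊆ V) : ∃ m, boundedPrefix σ m ⊆ V := by
  have hmono : Monotone fun m => {y | PiNat.cylinder y m ⊆ V} :=
    fun a b hab y hy => (PiNat.cylinder_anti y hab).trans hy
  obtain ⟨m, hm⟩ := (isCompact_Iic_nat_nat σ).elim_directed_cover _
    (isOpen_cylinder_subset V) (fun y hy => by
      obtain ⟨_, ⟨⟨z, n, rfl⟩, hyz, hz⟩⟩ :=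
        (PiNat.isTopologicalBasis_cylinders fun _ => ℕ).exists_subset_of_mem_open (h hy) hV
      refine mem_iUnion.2 ⟨n, ?_⟩
      simpa [PiNat.mem_cylinder_iff_eq.1 hyz] using hz) hmono.directed_le
  refine ⟨m, fun x hx => hm (mem_Iic.2 (inf_le_right : x ⊓ σ ≤ σ)) ?_⟩
  intro i hi
  simpa using hx i hi

lemma iInter_closure_image_boundedPrefix {Y : Type*} [TopologicalSpace Y] [T2Space Y]
    {g : (ℕ → ℕ) → Y} (hg : Continuous g) (σ : ℕ → ℕ) :
    ⋂ m, closure (g '' boundedPrefix σ m) = g '' Iic σ := by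
  refine Subset.antisymm (fun y hy => ?_) (subset_iInter fun m =>
    (image_mono (Iic_subset_boundedPrefix σ m)).trans subset_closure)
  by_contra hyn
  obtain ⟨U, V, hU, hV, hKU, hyV, hUV⟩ :=
    SeparatedNhds.of_isCompact_isCompact ((isCompact_Iic_nat_nat σ).image hg)
      (isCompact_singleton (x := y)) (disjoint_singleton_right.2 hyn)
  obtain ⟨m, hm⟩ := exists_boundedPrefix_subset (hU.preimage hg) (image_subset_iff.1 hKU)
  obtain ⟨z, hzV, hz⟩ := mem_closure_iff.1 (mem_iInter.1 hy m) V hV (hyV rfl)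
  exact disjoint_left.1 hUV (image_subset_iff.2 hm hz) hzV

section Measure

variable {Y : Type*} [TopologicalSpace Y] [T2Space Y] [MeasurableSpace Y]
  [OpensMeasurableSpace Y]

lemma le_measure_image_Iic_iff {g : (ℕ → ℕ) → Y} (hg : Continuous g) (σ : ℕ → ℕ)
    (μ : Measure Y) [IsFiniteMeasure μ] (t : ℝ≥0∞) :
    t ≤ μ (g '' Iic σ) ↔ ∀ m, t ≤ μ (closure (g '' boundedPrefix σ m)) := by
  have hanti : Antitone fun m => closure (g '' boundedPrefix σ m) :=
    fun a b h => closure_mono (image_mono (boundedPrefix_antitone σ h))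
  rw [← iInter_closure_image_boundedPrefix hg σ,
    hanti.measure_iInter (fun m => isClosed_closure.nullMeasurableSet) ⟨0, measure_ne_top _ _⟩,
    le_iInf_iff]

omit [TopologicalSpace Y] [T2Space Y] [OpensMeasurableSpace Y] in
lemma exists_lt_measure_image_boundedPrefix {g : (ℕ → ℕ) → Y} (μ : Measure Y) {t : ℝ≥0∞}
    (h : t < μ (range g)) : ∃ σ : ℕ → ℕ, ∀ m, t < μ (g '' boundedPrefix σ m) := by
  have hstep : ∀ (S : Set (ℕ → ℕ)) (m : ℕ), t < μ (g '' S) →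
      ∃ k, t < μ (g '' {x ∈ S | x m ≤ k}) := by
    intro S m hS
    have hmono : Monotone fun k : ℕ => g '' {x ∈ S | x m ≤ k} :=
      fun a b hab => image_mono fun x hx => ⟨hx.1, hx.2.trans hab⟩
    have hU : ⋃ k : ℕ, g '' {x ∈ S | x m ≤ k} = g '' S := by
      rw [← image_iUnion]
      congr 1
      ext x
      simp only [mem_iUnion, mem_ofPred_eq]
      exact ⟨fun ⟨_, h⟩ => h.1, fun h => ⟨x m, h, le_rfl⟩⟩
    rw [← hU, hmono.measure_iUnion] at hS
    exact lt_iSup_iff.1 hS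
  choose! k hk using hstep
  let S : ℕ → Set (ℕ → ℕ) := fun m => Nat.rec univ (fun m T => {x ∈ T | x m ≤ k T m}) m
  have hS : ∀ m, t < μ (g '' S m) := fun m => by
    induction m with
    | zero => simpa [S] using h
    | succ m ih => exact hk (S m) m ih
  refine ⟨fun m => k (S m) m, fun m => (hS m).trans_le (measure_mono (image_mono ?_))⟩
  induction m with
  | zero => exact fun _ _ i hi => absurd hi (Nat.not_lt_zero i)
  | succ m ih =>
    intro x hx i hi
    rcases Nat.lt_succ_iff_lt_or_eq.1 hi with hi | rfl
    · exact ih hx.1 i hi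
    · exact hx.2

lemma exists_le_measure_image_Iic {g : (ℕ → ℕ) → Y} (hg : Continuous g) (μ : Measure Y)
    [IsFiniteMeasure μ] {t : ℝ≥0∞} (h : t < μ (range g)) :
    ∃ σ : ℕ → ℕ, t ≤ μ (g '' Iic σ) := by
  obtain ⟨σ, hσ⟩ := exists_lt_measure_image_boundedPrefix μ h
  exact ⟨σ, (le_measure_image_Iic_iff hg σ μ t).2 fun m =>
    (hσ m).le.trans (measure_mono subset_closure)⟩

/-- Analytic sets are universally measurable. -/
lemma _root_.MeasureTheory.AnalyticSet.nullMeasurableSet {s : Set Y} (hs : AnalyticSet s)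
    (μ : Measure Y) [IsFiniteMeasure μ] : NullMeasurableSet s μ := by
  rw [AnalyticSet] at hs
  rcases hs with rfl | ⟨g, hg, rfl⟩
  · exact .empty
  rcases eq_or_ne (μ (range g)) 0 with h0 | h0
  · exact .of_null h0
  obtain ⟨u, -, hu, hlim⟩ := exists_seq_strictMono_tendsto' (bot_lt_iff_ne_bot.2 h0)
  choose σ hσ using fun n => exists_le_measure_image_Iic hg μ (hu n).2
  have hm : MeasurableSet (⋃ n, g '' Iic (σ n)) := .iUnion fun n =>
    ((isCompact_Iic_nat_nat (σ n)).image hg).isClosed.measurableSet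
  have hsub : (⋃ n, g '' Iic (σ n)) ⊆ range g := iUnion_subset fun n => image_subset_range _ _
  have hle : μ (range g) ≤ μ (⋃ n, g '' Iic (σ n)) :=
    le_of_tendsto' hlim fun n =>
      (hσ n).trans (measure_mono (subset_iUnion (fun n => g '' Iic (σ n)) n))
  exact hm.nullMeasurableSet.congr (ae_eq_of_subset_of_measure_ge hsub hle
    hm.nullMeasurableSet (measure_ne_top _ _))

lemma isClosed_le_measure_image_Iic [HasOuterApproxClosed Y] {g : (ℕ → ℕ) → Y}
    (hg : Continuous g) (t : ℝ≥0∞) :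
    IsClosed {x : ProbabilityMeasure Y × (ℕ → ℕ) | t ≤ x.1.toMeasure (g '' Iic x.2)} := by
  rw [isClosed_iff_forall_filter]
  rintro ⟨q, σ⟩ L _ hL hlim
  rw [mem_ofPred_eq, le_measure_image_Iic_iff hg]
  intro m
  have h1 : Tendsto Prod.fst L (𝓝 q) := (continuous_fst.tendsto (q, σ)).mono_left hlim
  have h2 : Tendsto Prod.snd L (𝓝 σ) := (continuous_snd.tendsto (q, σ)).mono_left hlim
  have h3 : ∀ᶠ x in L, x.2 ∈ PiNat.cylinder σ m :=
    h2.eventually_mem ((PiNat.isOpen_cylinder (fun _ => ℕ) σ m).mem_nhds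
      (PiNat.self_mem_cylinder σ m))
  have h4 : ∀ᶠ x in L, t ≤ x.1.toMeasure (closure (g '' boundedPrefix σ m)) := by
    filter_upwards [h3, Filter.le_principal_iff.1 hL] with x hx hxt
    refine le_trans hxt (measure_mono ((image_mono ?_).trans subset_closure))
    intro y hy i hi
    exact (hy i).trans_eq (hx i hi)
  exact (le_limsup_of_frequently_le h4.frequently).trans
    (ProbabilityMeasure.limsup_measure_closed_le_of_tendsto h1 isClosed_closure)

lemma analyticSet_lt_measure_of_polishSpace [HasOuterApproxClosed Y]
    [PolishSpace (ProbabilityMeasure Y)] {s : Set Y} (hs : AnalyticSet s) (t : ℝ≥0∞) :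
    AnalyticSet {p : ProbabilityMeasure Y | t < p.toMeasure s} := by
  rw [AnalyticSet] at hs
  rcases hs with rfl | ⟨g, hg, rfl⟩
  · simpa using analyticSet_empty
  have : {p : ProbabilityMeasure Y | t < p.toMeasure (range g)} =
      ⋃ q : {q : ℚ // t < ENNReal.ofReal q}, Prod.fst ''
        {x : ProbabilityMeasure Y × (ℕ → ℕ) |
          ENNReal.ofReal q.1 ≤ x.1.toMeasure (g '' Iic x.2)} := by
    ext p
    simp only [mem_ofPred_eq, mem_iUnion, mem_image, Prod.exists, exists_and_right, exists_eq_right]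
    constructor
    · intro h
      obtain ⟨q, -, hq, hqp⟩ := ENNReal.lt_iff_exists_rat_btwn.1 h
      exact ⟨⟨q, hq⟩, exists_le_measure_image_Iic hg _ hqp⟩
    · rintro ⟨q, σ, h⟩
      exact q.2.trans_le (h.trans (measure_mono (image_subset_range _ _)))
  rw [this]
  exact .iUnion fun q =>
    (isClosed_le_measure_image_Iic hg _).analyticSet.image_of_continuous continuous_fst

end Measure

lemma _root_.Topology.IsEmbedding.analyticSet_of_image {α β : Type*} [TopologicalSpace α]
    [TopologicalSpace β] {f : α → β} (hf : IsEmbedding f) {s : Set α}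
    (hs : AnalyticSet (f '' s)) : AnalyticSet s := by
  rw [AnalyticSet] at hs ⊢
  rcases hs with h | ⟨g, hg, hgs⟩
  · exact .inl (image_eq_empty.1 h)
  · choose k hk hfk using fun x => hgs.subset (mem_range_self x)
    refine .inr ⟨k, hf.continuous_iff.2 (by simpa [Function.comp_def, hfk] using hg), ?_⟩
    refine Subset.antisymm (range_subset_iff.2 hk) fun y hy => ?_
    obtain ⟨x, hx⟩ := hgs.superset (mem_image_of_mem f hy)
    exact ⟨x, hf.injective ((hfk x).trans hx)⟩

lemma isEmbedding_probabilityMeasure_map {Y Z : Type*} [TopologicalSpace Y] [PolishSpace Y]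
    [MeasurableSpace Y] [BorelSpace Y] [TopologicalSpace Z] [PolishSpace Z]
    [MeasurableSpace Z] [BorelSpace Z] {e : Y → Z} (he : IsEmbedding e) :
    IsEmbedding fun p : ProbabilityMeasure Y =>
      p.map he.continuous.measurable.aemeasurable := by
  have hme : MeasurableEmbedding e := he.continuous.measurableEmbedding he.injective
  refine ⟨isInducing_iff_nhds.2 fun p => le_antisymm ?_ ?_, fun p q h => ?_⟩
  · exact ((ProbabilityMeasure.continuous_map he.continuous).tendsto p).le_comap
  · refine tendsto_id'.1 (tendsto_of_forall_isClosed_limsup_le' fun F hF => ?_)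
    obtain ⟨C, hC, rfl⟩ := he.isClosed_iff.1 hF
    have := ProbabilityMeasure.limsup_measure_closed_le_of_tendsto
      (tendsto_comap (f := fun p : ProbabilityMeasure Y =>
        p.map he.continuous.measurable.aemeasurable)
        (x := 𝓝 (p.map he.continuous.measurable.aemeasurable))) hC
    simpa [ProbabilityMeasure.toMeasure_map, hme.map_apply] using this
  · ext s hs
    have := congrArg (fun r : ProbabilityMeasure Z => r.toMeasure (e '' s)) h
    simpa [ProbabilityMeasure.toMeasure_map, hme.map_apply,
      preimage_image_eq _ he.injective] using this

/-- The superlevel sets of `p ↦ p s` are analytic for an analytic set `s`. -/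
lemma analyticSet_lt_measure {Y : Type*} [TopologicalSpace Y] [PolishSpace Y]
    [MeasurableSpace Y] [BorelSpace Y] {s : Set Y} (hs : AnalyticSet s) (t : ℝ≥0∞) :
    AnalyticSet {p : ProbabilityMeasure Y | t < p.toMeasure s} := by
  let := upgradeIsCompletelyMetrizable Y
  obtain ⟨e, he⟩ := Metric.PiNatEmbed.exists_embedding_to_hilbert_cube (X := Y)
  have hme : MeasurableEmbedding e := he.continuous.measurableEmbedding he.injective
  let := metrizableSpaceMetric (ProbabilityMeasure (ℕ → unitInterval))
  have : PolishSpace (ProbabilityMeasure (ℕ → unitInterval)) := inferInstance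
  refine (isEmbedding_probabilityMeasure_map he).analyticSet_of_image ?_
  have himg : (fun p : ProbabilityMeasure Y => p.map he.continuous.measurable.aemeasurable) ''
        {p | t < p.toMeasure s} =
      {q | t < q.toMeasure (e '' s)} ∩
        ⋂ r : {r : ℚ // ENNReal.ofReal r < 1}, {q | ENNReal.ofReal r.1 < q.toMeasure (range e)} := by
    ext q
    simp only [mem_image, mem_ofPred_eq, mem_inter_iff, mem_iInter]
    constructor
    · rintro ⟨p, hp, rfl⟩
      refine ⟨?_, fun r => ?_⟩
      · simpa [ProbabilityMeasure.toMeasure_map, hme.map_apply,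
          preimage_image_eq _ he.injective] using hp
      · simpa [ProbabilityMeasure.toMeasure_map, hme.map_apply] using r.2
    · rintro ⟨hq, hq1⟩
      have hone : q.toMeasure (range e) = 1 := by
        refine le_antisymm prob_le_one (le_of_forall_lt fun a ha => ?_)
        obtain ⟨r, -, har, hr⟩ := ENNReal.lt_iff_exists_rat_btwn.1 ha
        exact har.trans (hq1 ⟨r, hr⟩)
      have hmap : (q.toMeasure.comap e).map e = q.toMeasure := by
        rw [hme.map_comap]
        exact Measure.restrict_eq_self_of_ae_mem
          ((prob_compl_eq_zero_iff hme.measurableSet_range).2 hone)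
      refine ⟨⟨q.toMeasure.comap e, ⟨?_⟩⟩, ?_, ?_⟩
      · rw [hme.comap_apply, image_univ, hone]
      · simpa [hme.comap_apply] using hq
      · exact Subtype.ext hmap
  rw [himg, inter_eq_iInter]
  have : Nonempty {r : ℚ // ENNReal.ofReal r < 1} := ⟨0, by simp⟩
  refine .iInter fun b => ?_
  cases b
  · exact .iInter fun r => analyticSet_lt_measure_of_polishSpace
      (analyticSet_range_of_polishSpace he.continuous) _
  · exact analyticSet_lt_measure_of_polishSpace (hs.image_of_continuous he.continuous) _

end Analytic

/-- A function into a linear order all of whose strict sublevel sets are analytic. -/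
def StrictSemianalytic {γ α : Type*} [TopologicalSpace γ] [LT α] (f : γ → α) : Prop :=
  ∀ t, AnalyticSet {x | f x < t}

namespace StrictSemianalytic

open Set TopologicalSpace

variable {γ α : Type*} [TopologicalSpace γ]

section Order

variable [CompleteLinearOrder α] [DenselyOrdered α] [TopologicalSpace α] [OrderTopology α]
  [SecondCountableTopology α]

lemma analyticSet_le [T2Space γ] (huniv : AnalyticSet (univ : Set γ)) {f : γ → α}
    (hf : StrictSemianalytic f) (t : α) : AnalyticSet {x | f x ≤ t} := by
  obtain ⟨D, hD, hdense⟩ := exists_countable_dense α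
  have : Countable D := hD.to_subtype
  have h : {x | f x ≤ t} = ⋂ o : Option {q : D // t < q},
      o.elim univ fun q => {x | f x < (q : α)} := by
    ext x
    simp only [mem_ofPred_eq, mem_iInter, Option.forall, Option.elim, mem_univ, true_and]
    refine ⟨fun h q => h.trans_lt q.2, fun h => le_of_not_gt fun hlt => ?_⟩
    obtain ⟨q, hq, htq, hqx⟩ := hdense.exists_between hlt
    exact lt_asymm hqx (h ⟨⟨q, hq⟩, htq⟩)
  rw [h]
  exact .iInter fun o => by
    cases o
    · exact huniv
    · exact hf _

lemma monotone_comp [T2Space γ] (huniv : AnalyticSet (univ : Set γ)) {β : Type*}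
    [LinearOrder β] {f : γ → α} (hf : StrictSemianalytic f) {h : α → β} (hh : Monotone h) :
    StrictSemianalytic fun x => h (f x) := by
  intro t
  by_cases hmax : ∃ b, h b < t ∧ ∀ y, h y < t → y ≤ b
  · obtain ⟨b, hb, hmax⟩ := hmax
    convert hf.analyticSet_le huniv b using 1
    ext x
    exact ⟨hmax _, fun hx => (hh hx).trans_lt hb⟩
  · push Not at hmax
    obtain ⟨D, hD, hdense⟩ := exists_countable_dense α
    have : Countable D := hD.to_subtype
    have heq : {x | h (f x) < t} = ⋃ q : {q : D // h q < t}, {x | f x < (q : α)} := by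
      ext x
      simp only [mem_ofPred_eq, mem_iUnion]
      constructor
      · intro hx
        obtain ⟨y, hy, hxy⟩ := hmax _ hx
        obtain ⟨q, hq, hxq, hqy⟩ := hdense.exists_between hxy
        exact ⟨⟨⟨q, hq⟩, (hh hqy.le).trans_lt hy⟩, hxq⟩
      · rintro ⟨q, hq⟩
        exact (hh hq.le).trans_lt q.2
    rw [heq]
    exact .iUnion fun q => hf _

lemma iSup [T2Space γ] {ι : Type*} [Countable ι] [Nonempty ι] {f : ι → γ → α}
    (hf : ∀ i, StrictSemianalytic (f i)) : StrictSemianalytic fun x => ⨆ i, f i x := by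
  intro t
  obtain ⟨D, hD, hdense⟩ := exists_countable_dense α
  have : Countable D := hD.to_subtype
  have heq : {x | ⨆ i, f i x < t} = ⋃ q : {q : D // q < t}, ⋂ i, {x | f i x < (q : α)} := by
    ext x
    simp only [mem_ofPred_eq, mem_iUnion, mem_iInter]
    constructor
    · intro hx
      obtain ⟨q, hq, hxq, hqt⟩ := hdense.exists_between hx
      exact ⟨⟨⟨q, hq⟩, hqt⟩, fun i => (le_iSup (f · x) i).trans_lt hxq⟩
    · rintro ⟨q, hq⟩
      exact (iSup_le fun i => (hq i).le).trans_lt q.2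
  rw [heq]
  exact .iUnion fun q => .iInter fun i => hf i _

omit [DenselyOrdered α] [TopologicalSpace α] [OrderTopology α] [SecondCountableTopology α] in
lemma iInf {ι : Type*} [Countable ι] {f : ι → γ → α}
    (hf : ∀ i, StrictSemianalytic (f i)) : StrictSemianalytic fun x => ⨅ i, f i x := by
  intro t
  simp only [iInf_lt_iff, ofPred_exists]
  exact .iUnion fun i => hf i t

lemma limsup [T2Space γ] {f : ℕ → γ → α}
    (hf : ∀ n, StrictSemianalytic (f n)) :
    StrictSemianalytic fun x => Filter.limsup (fun n => f n x) atTop := by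
  simp only [limsup_eq_iInf_iSup_of_nat']
  exact iInf fun n => iSup fun i => hf _

end Order

lemma const [LinearOrder α] (huniv : AnalyticSet (univ : Set γ)) (a : α) :
    StrictSemianalytic fun _ : γ => a := by
  intro t
  by_cases h : a < t
  · simpa [h] using huniv
  · simpa [h] using analyticSet_empty

lemma comp {δ : Type*} [TopologicalSpace δ] [PolishSpace δ] [T2Space γ] [LT α] {f : γ → α}
    (hf : StrictSemianalytic f) {g : δ → γ} (hg : Continuous g) :
    StrictSemianalytic fun x => f (g x) :=
  fun t => (hf t).preimage hg

lemma ennreal_add [T2Space γ] {f g : γ → ℝ≥0∞} (hf : StrictSemianalytic f)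
    (hg : StrictSemianalytic g) : StrictSemianalytic fun x => f x + g x := by
  intro t
  have heq : {x | f x + g x < t} = ⋃ q : ℚ, ⋂ b : Bool, bif b then
      {x | f x < ENNReal.ofReal q} else {x | g x < t - ENNReal.ofReal q} := by
    ext x
    simp only [mem_ofPred_eq, mem_iUnion, mem_iInter, Bool.forall_bool, cond_true, cond_false]
    constructor
    · intro h
      obtain ⟨q, -, hq, hqt⟩ := ENNReal.lt_iff_exists_rat_btwn.1 (lt_tsub_iff_right.2 h)
      exact ⟨q, lt_tsub_iff_left.2 (lt_tsub_iff_right.1 hqt), hq⟩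
    · rintro ⟨q, h1, h2⟩
      exact (add_le_add_left h2.le _).trans_lt (lt_tsub_iff_left.1 h1)
  rw [heq]
  exact .iUnion fun q => .iInter fun b => by
    cases b
    · exact hg _
    · exact hf _

lemma ennreal_tsum [T2Space γ] (huniv : AnalyticSet (univ : Set γ)) {f : ℕ → γ → ℝ≥0∞}
    (hf : ∀ n, StrictSemianalytic (f n)) : StrictSemianalytic fun x => ∑' n, f n x := by
  simp only [ENNReal.tsum_eq_iSup_nat]
  refine iSup fun n => ?_
  induction n with
  | zero => simpa using const huniv (0 : ℝ≥0∞)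
  | succ n ih => simpa only [Finset.sum_range_succ] using ih.ennreal_add (hf n)

lemma ereal_add [T2Space γ] {f g : γ → EReal} (hf : StrictSemianalytic f)
    (hg : StrictSemianalytic g) (hfbot : ∀ x, f x ≠ ⊥) (hgbot : ∀ x, g x ≠ ⊥) :
    StrictSemianalytic fun x => f x + g x := by
  intro t
  have heq : {x | f x + g x < t} = ⋃ q : ℚ, ⋂ b : Bool, bif b then
      {x | f x < ((q : ℝ) : EReal)} else {x | g x < t - ((q : ℝ) : EReal)} := by
    ext x
    simp only [mem_ofPred_eq, mem_iUnion, mem_iInter, Bool.forall_bool, cond_true, cond_false]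
    have hq : ∀ q : ℚ, g x < t - ((q : ℝ) : EReal) ↔ ((q : ℝ) : EReal) + g x < t := fun q => by
      rw [EReal.lt_sub_iff_add_lt (.inl (EReal.coe_ne_bot _)) (.inl (EReal.coe_ne_top _)), add_comm]
    simp only [hq]
    constructor
    · intro h
      have h' : f x < t - g x := by
        by_cases hgt : g x = ⊤
        · rw [hgt, EReal.add_top_of_ne_bot (hfbot x)] at h
          exact absurd h not_top_lt
        · exact (EReal.lt_sub_iff_add_lt (.inl (hgbot x)) (.inl hgt)).2 h
      obtain ⟨q, hxq, hqt⟩ := EReal.lt_iff_exists_rat_btwn.1 h'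
      exact ⟨q, (EReal.add_lt_of_lt_sub hqt), hxq⟩
    · rintro ⟨q, h1, h2⟩
      exact (add_le_add_left h2.le _).trans_lt h1
  rw [heq]
  exact .iUnion fun q => .iInter fun b => by
    cases b
    · exact hg _
    · exact hf _

end StrictSemianalytic

/-- Counting the positive integers below `y` approximates `y` up to `1`. -/
lemma tsum_ite_natCast_le (y : ℝ≥0∞) :
    (∑' k : ℕ, if ((k + 1 : ℕ) : ℝ≥0∞) ≤ y then 1 else 0) ≤ y ∧
      y ≤ (∑' k : ℕ, if ((k + 1 : ℕ) : ℝ≥0∞) ≤ y then (1 : ℝ≥0∞) else 0) + 1 := by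
  induction y with
  | top => simp
  | coe y =>
    have h : (∑' k : ℕ, if ((k + 1 : ℕ) : ℝ≥0∞) ≤ y then (1 : ℝ≥0∞) else 0) = ⌊y⌋₊ := by
      rw [tsum_eq_sum (s := Finset.range ⌊y⌋₊)]
      · rw [Finset.sum_congr rfl (g := fun _ => 1)]
        · simp
        · intro k hk
          rw [if_pos]
          have := (Nat.le_floor_iff zero_le).1 (Nat.succ_le_of_lt (Finset.mem_range.1 hk))
          exact_mod_cast this
      · intro k hk
        rw [if_neg]
        intro hle
        refine hk (Finset.mem_range.2 (Nat.le_floor ?_))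
        exact_mod_cast hle
    rw [h]
    exact ⟨by exact_mod_cast Nat.floor_le zero_le,
      by exact_mod_cast (Nat.lt_floor_add_one y).le⟩

lemma lintegral_eq_iSup_tsum_measure_ge {Y : Type*} [MeasurableSpace Y] (μ : Measure Y)
    [IsProbabilityMeasure μ] {f : Y → ℝ≥0∞} (hf : AEMeasurable f μ) :
    ∫⁻ x, f x ∂μ = ⨆ n : ℕ, ∑' k : ℕ,
      ((n + 1 : ℕ) : ℝ≥0∞)⁻¹ * μ {x | ((k + 1 : ℕ) : ℝ≥0∞) / (n + 1 : ℕ) ≤ f x} := by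
  have hS : ∀ n : ℕ, ∑' k : ℕ,
      ((n + 1 : ℕ) : ℝ≥0∞)⁻¹ * μ {x | ((k + 1 : ℕ) : ℝ≥0∞) / (n + 1 : ℕ) ≤ f x} =
      ∫⁻ x, ((n + 1 : ℕ) : ℝ≥0∞)⁻¹ *
        ∑' k : ℕ, (if ((k + 1 : ℕ) : ℝ≥0∞) ≤ f x * (n + 1 : ℕ) then 1 else 0) ∂μ := by
    intro n
    have hset : ∀ k : ℕ, NullMeasurableSet
        {x | ((k + 1 : ℕ) : ℝ≥0∞) / (n + 1 : ℕ) ≤ f x} μ := fun k =>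
      hf.nullMeasurableSet_preimage measurableSet_Ici
    have hind : ∀ k x, (if ((k + 1 : ℕ) : ℝ≥0∞) ≤ f x * (n + 1 : ℕ) then (1 : ℝ≥0∞) else 0) =
        {x | ((k + 1 : ℕ) : ℝ≥0∞) / (n + 1 : ℕ) ≤ f x}.indicator 1 x := by
      intro k x
      rw [Set.indicator_apply]
      congr 1
      rw [Set.mem_ofPred_eq, ENNReal.div_le_iff (by simp) (by simp)]
    simp only [hind]
    rw [lintegral_const_mul' _ _ (by simp), lintegral_tsum, ENNReal.tsum_mul_left]
    · simp only [lintegral_indicator_one₀ (hset _)]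
    · exact fun k => aemeasurable_one.indicator₀ (hset k)
  simp only [hS]
  refine le_antisymm ?_ (iSup_le fun n => lintegral_mono fun x => ?_)
  · have hlim : Tendsto (fun n : ℕ => (⨆ n : ℕ, ∫⁻ x, ((n + 1 : ℕ) : ℝ≥0∞)⁻¹ *
        ∑' k : ℕ, (if ((k + 1 : ℕ) : ℝ≥0∞) ≤ f x * (n + 1 : ℕ) then 1 else 0) ∂μ) +
        ((n + 1 : ℕ) : ℝ≥0∞)⁻¹) atTop (𝓝 ((⨆ n : ℕ, ∫⁻ x, ((n + 1 : ℕ) : ℝ≥0∞)⁻¹ *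
        ∑' k : ℕ, (if ((k + 1 : ℕ) : ℝ≥0∞) ≤ f x * (n + 1 : ℕ) then 1 else 0) ∂μ) + 0)) :=
      tendsto_const_nhds.add
        ((tendsto_add_atTop_iff_nat 1).2 ENNReal.tendsto_inv_nat_nhds_zero)
    rw [add_zero] at hlim
    refine ge_of_tendsto' hlim fun n => ?_
    calc ∫⁻ x, f x ∂μ ≤ ∫⁻ x, (((n + 1 : ℕ) : ℝ≥0∞)⁻¹ *
          ∑' k : ℕ, (if ((k + 1 : ℕ) : ℝ≥0∞) ≤ f x * (n + 1 : ℕ) then 1 else 0)) +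
          ((n + 1 : ℕ) : ℝ≥0∞)⁻¹ ∂μ := by
          refine lintegral_mono fun x => ?_
          calc f x = ((n + 1 : ℕ) : ℝ≥0∞)⁻¹ * (f x * (n + 1 : ℕ)) := by
                rw [mul_comm (f x), ← mul_assoc, ENNReal.inv_mul_cancel (by simp) (by simp),
                  one_mul]
            _ ≤ _ := by
                refine (mul_le_mul_right (tsum_ite_natCast_le _).2 _).trans ?_
                rw [mul_add, mul_one]
      _ = (∫⁻ x, ((n + 1 : ℕ) : ℝ≥0∞)⁻¹ *
          ∑' k : ℕ, (if ((k + 1 : ℕ) : ℝ≥0∞) ≤ f x * (n + 1 : ℕ) then 1 else 0) ∂μ) +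
          ((n + 1 : ℕ) : ℝ≥0∞)⁻¹ := by
          rw [lintegral_add_right _ measurable_const, lintegral_const, measure_univ, mul_one]
      _ ≤ _ := add_le_add_left (le_iSup (fun n : ℕ => ∫⁻ x, ((n + 1 : ℕ) : ℝ≥0∞)⁻¹ *
          ∑' k : ℕ, (if ((k + 1 : ℕ) : ℝ≥0∞) ≤ f x * (n + 1 : ℕ) then 1 else 0) ∂μ) n) _
  · calc _ ≤ ((n + 1 : ℕ) : ℝ≥0∞)⁻¹ * (f x * (n + 1 : ℕ)) :=
          mul_le_mul_right (tsum_ite_natCast_le _).1 _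
      _ = f x := by
          rw [mul_comm (f x), ← mul_assoc, ENNReal.inv_mul_cancel (by simp) (by simp), one_mul]

section Integral

open Set

variable {Y : Type*} [TopologicalSpace Y] [PolishSpace Y] [MeasurableSpace Y] [BorelSpace Y]

lemma analyticSet_univ_probabilityMeasure :
    AnalyticSet (univ : Set (ProbabilityMeasure Y)) := by
  convert analyticSet_lt_measure (Y := Y) (MeasurableSet.univ.analyticSet) 0
  ext
  simp

lemma StrictSemianalytic.aemeasurable {f : Y → ℝ≥0∞} (hf : StrictSemianalytic f)
    (μ : Measure Y) [IsFiniteMeasure μ] : AEMeasurable f μ := by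
  have h : NullMeasurable f μ := measurable_of_Iio fun t => (hf t).nullMeasurableSet μ
  exact h.aemeasurable

lemma StrictSemianalytic.measure_ge {f : Y → ℝ≥0∞} (hf : StrictSemianalytic f) (t : ℝ≥0∞) :
    StrictSemianalytic fun p : ProbabilityMeasure Y => p.toMeasure {x | t ≤ f x} := by
  intro s
  by_cases hs : 1 < s
  · convert analyticSet_univ_probabilityMeasure (Y := Y)
    ext p
    simpa using prob_le_one.trans_lt hs
  convert analyticSet_lt_measure (hf t) (1 - s) using 1
  ext p
  have hc : {x | t ≤ f x} = {x | f x < t}ᶜ := by ext; simp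
  simp only [mem_ofPred_eq]
  rw [hc, prob_compl_eq_one_sub₀ ((hf t).nullMeasurableSet _)]
  push Not at hs
  rw [ENNReal.sub_lt_iff_lt_right (measure_ne_top _ _) prob_le_one,
    ENNReal.sub_lt_iff_lt_right (ne_top_of_le_ne_top ENNReal.one_ne_top hs) hs, add_comm]

/-- Integration of semianalytic functions is a semianalytic function of the measure. -/
lemma StrictSemianalytic.lintegral {f : Y → ℝ≥0∞} (hf : StrictSemianalytic f) :
    StrictSemianalytic fun p : ProbabilityMeasure Y => ∫⁻ x, f x ∂p.toMeasure := by
  let := TopologicalSpace.upgradeIsCompletelyMetrizable Y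
  simp only [fun p : ProbabilityMeasure Y =>
    lintegral_eq_iSup_tsum_measure_ge p.toMeasure (hf.aemeasurable p.toMeasure)]
  refine .iSup fun n => .ennreal_tsum analyticSet_univ_probabilityMeasure fun k => ?_
  exact (hf.measure_ge _).monotone_comp analyticSet_univ_probabilityMeasure
    fun a b h => mul_le_mul_right h _

end Integral

lemma _root_.EReal.sum_ne_bot {ι : Type*} {s : Finset ι} {v : ι → EReal}
    (hv : ∀ i ∈ s, v i ≠ ⊥) : ∑ i ∈ s, v i ≠ ⊥ :=
  Finset.sum_induction v (· ≠ ⊥) (fun _ _ ha hb => by simp [EReal.add_eq_bot_iff, ha, hb])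
    (by simp) hv

lemma _root_.EReal.coe_sum {ι : Type*} (s : Finset ι) (w : ι → ℝ) :
    ((∑ i ∈ s, w i : ℝ) : EReal) = ∑ i ∈ s, (w i : EReal) :=
  map_sum (⟨⟨Real.toEReal, EReal.coe_zero⟩, EReal.coe_add⟩ : ℝ →+ EReal) w s

lemma esum_eq_sum {n : ℕ} (v : Fin n → EReal) (hv : ∀ i, v i ≠ ⊥) : esum v = ∑ i, v i := by
  rw [esum]
  by_cases h : ∃ i, v i = ⊤
  · obtain ⟨i, hi⟩ := h
    have hpos : ∑ i, ePos (v i) = ⊤ :=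
      ENNReal.sum_eq_top.2 ⟨i, Finset.mem_univ i, by simp [ePos, hi]⟩
    rw [if_pos hpos, ← Finset.add_sum_erase _ _ (Finset.mem_univ i), hi,
      EReal.top_add_of_ne_bot (EReal.sum_ne_bot fun j _ => hv j)]
  · push Not at h
    lift v to Fin n → ℝ using fun i => ⟨h i, hv i⟩
    have hcast : ∀ w : Fin n → ℝ, (∑ i, ePos (w i) : ℝ≥0∞) =
        ENNReal.ofReal (∑ i, max (w i) 0) := fun w => by
      rw [ENNReal.ofReal_sum_of_nonneg fun i _ => le_max_right _ _]
      simp [ePos]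
    have hnn : ∀ w : Fin n → ℝ, 0 ≤ ∑ i, max (w i) 0 :=
      fun w => Finset.sum_nonneg fun i _ => le_max_right _ _
    simp only [← EReal.coe_neg]
    rw [hcast, hcast fun i => -v i, if_neg ENNReal.ofReal_ne_top, EReal.coe_ennreal_ofReal,
      EReal.coe_ennreal_ofReal, max_eq_left (hnn _), max_eq_left (hnn _), ← EReal.coe_sub,
      ← Finset.sum_sub_distrib, ← EReal.coe_sum]
    congr 2 with i
    rcases le_total (v i) 0 with h | h <;> simp [h]

lemma LowerSemianalytic.strictSemianalytic {γ : Type*} [TopologicalSpace γ] {f : γ → EReal}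
    (hf : LowerSemianalytic f) : StrictSemianalytic f := by
  intro t
  have heq : {x | f x < t} = ⋃ q : {q : ℚ // ((q : ℝ) : EReal) < t},
      {x | f x ≤ ((q.1 : ℝ) : EReal)} := by
    ext x
    simp only [Set.mem_ofPred_eq, Set.mem_iUnion]
    constructor
    · intro h
      obtain ⟨q, hxq, hqt⟩ := EReal.lt_iff_exists_rat_btwn.1 h
      exact ⟨⟨q, hqt⟩, hxq.le⟩
    · rintro ⟨q, hq⟩
      exact hq.trans_lt q.2
  rw [heq]
  exact .iUnion fun q => hf _

lemma StrictSemianalytic.pathSum {X A : Type*} [TopologicalSpace X] [PolishSpace X]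
    [TopologicalSpace A] [PolishSpace A] {c : X × A → EReal} (hc : StrictSemianalytic c)
    (hbot : ∀ xa, c xa ≠ ⊥) (n j : ℕ) :
    StrictSemianalytic fun ω : Traj X A => pathSum c n j ω := by
  have huniv : AnalyticSet (Set.univ : Set (Traj X A)) := isClosed_univ.analyticSet
  simp only [PaperStmt.pathSum, esum_eq_sum _ fun _ => hbot _]
  simp only [fun ω : Traj X A => Fin.sum_univ_eq_sum_range (fun k => c (ω (k + j))) n]
  induction n with
  | zero => simpa using const huniv (0 : EReal)
  | succ n ih =>
    simpa only [Finset.sum_range_succ] using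
      ih.ereal_add (hc.comp (continuous_apply (n + j)))
        (fun _ => EReal.sum_ne_bot fun _ _ => hbot _) fun _ => hbot _

lemma monotone_avg (n : ℕ) : Monotone (avg n) := fun _ _ h =>
  mul_le_mul_of_nonneg_left h (EReal.coe_nonneg.2 (by positivity))

/-- first part of Lemma `lem-risk-lsa`: for `c` lower semianalytic and
real-valued on `Γ` (equal to `+∞` off `Γ`) and `ψ` strictly increasing, nonnegative and
continuous, with `ψ⁻¹` extended to a non-decreasing left inverse, the functionals `J_ψ`
and `Ĵ_ψ` are lower semianalytic on `P(Ω)`. -/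
theorem statement9
    {X A : Type*} [TopologicalSpace X] [PolishSpace X] [MeasurableSpace X] [BorelSpace X]
    [TopologicalSpace A] [PolishSpace A] [MeasurableSpace A] [BorelSpace A]
    (Γ : Set (X × A)) (hΓ : MeasureTheory.AnalyticSet Γ)
    (c : X × A → EReal) (hc : LowerSemianalytic c)
    (hreal : ∀ xa ∈ Γ, c xa ≠ ⊤ ∧ c xa ≠ ⊥)
    (hext : ∀ xa ∉ Γ, c xa = ⊤)
    (ψ : EReal → ℝ≥0∞) (hψmono : StrictMono ψ) (hψcont : Continuous ψ)
    (ψinv : ℝ≥0∞ → EReal) (hψinvmono : Monotone ψinv)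
    (hψinv : ∀ y : EReal, ψinv (ψ y) = y) :
    LowerSemianalytic (Jpsi c ψ ψinv) ∧ LowerSemianalytic (JpsiHat c ψ ψinv) := by
  have hbot : ∀ xa, c xa ≠ ⊥ := fun xa => by
    by_cases h : xa ∈ Γ
    · exact (hreal xa h).2
    · simp [hext xa h]
  have huniv : AnalyticSet (Set.univ : Set (ProbabilityMeasure (Traj X A))) :=
    analyticSet_univ_probabilityMeasure
  have hmono : ∀ n, Monotone fun y => avg n (ψinv y) :=
    fun n => (monotone_avg n).comp hψinvmono
  have hcost : ∀ n j, StrictSemianalytic fun p : ProbabilityMeasure (Traj X A) =>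
      avg n (ψinv (∫⁻ ω, ψ (pathSum c n j ω) ∂p.toMeasure)) := fun n j =>
    ((hc.strictSemianalytic.pathSum hbot n j).monotone_comp isClosed_univ.analyticSet
      hψmono.monotone).lintegral.monotone_comp huniv (hmono n)
  have hT2 : T2Space (ProbabilityMeasure (Traj X A)) := by
    let := TopologicalSpace.upgradeIsCompletelyMetrizable (Traj X A)
    infer_instance
  exact ⟨fun r => (StrictSemianalytic.limsup fun n => hcost n 0).analyticSet_le huniv r,
    fun r => (StrictSemianalytic.limsup fun n => .iSup fun j => hcost n j).analyticSet_le huniv r⟩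

end PaperStmt
end
end

section
/- Let c : 𝕏 × 𝔸 → [−∞, +∞] be lower semianalytic and real-valued on Γ (extended by +∞ off Γ), let c̄(ω) := limsup_{n→∞} n^{-1} Σ_{k=0}^{n-1} c(x_k, a_k), and let α ∈ (0,1]. Then both the CVaR functional φ₁(p) := inf over z ∈ ℝ of { z + α^{-1} ∫_Ω (c̄(ω) − z)_+ p(dω) } and the VaR functional φ₂(p) := inf{ z ∈ ℝ : p{ω : c̄(ω) ≤ z} ≥ 1 − α } are lower semianalytic on P(Ω). -/
open MeasureTheory ProbabilityTheory Filter
open scoped ENNReal NNReal Topology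

noncomputable section

namespace PaperStmt

/-- The compact box of all integer sequences dominated by `a`. -/
def natBox (a : ℕ → ℕ) : Set (ℕ → ℕ) := {b | ∀ i, b i ≤ a i}

/-- The sequences whose first `k` terms are dominated by those of `a`. -/
def natBoxUpTo (a : ℕ → ℕ) (k : ℕ) : Set (ℕ → ℕ) := {b | ∀ i < k, b i ≤ a i}

lemma isCompact_natBox (a : ℕ → ℕ) : IsCompact (natBox a) := by
  have : natBox a = Set.univ.pi fun i => Set.Iic (a i) := by
    ext b; simp [natBox, Pi.le_def]
  rw [this]
  exact isCompact_univ_pi fun i => (Set.finite_Iic (a i)).isCompact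

lemma natBox_subset_natBoxUpTo {a b : ℕ → ℕ} {k : ℕ} (h : ∀ i < k, b i = a i) :
    natBox b ⊆ natBoxUpTo a k := fun _ hx i hi => (hx i).trans (h i hi).le

/-- An open set containing a compact box contains all sequences dominated on a long enough
initial segment. -/
lemma exists_natBoxUpTo_subset {a : ℕ → ℕ} {V : Set (ℕ → ℕ)} (hV : IsOpen V)
    (h : natBox a ⊆ V) : ∃ k, natBoxUpTo a k ⊆ V := by
  have hcyl : ∀ x ∈ natBox a, ∃ n, PiNat.cylinder x n ⊆ V := by
    intro x hx
    obtain ⟨_, ⟨y, n, rfl⟩, hxy, hn⟩ :=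
      (PiNat.isTopologicalBasis_cylinders (fun _ : ℕ => ℕ)).exists_subset_of_mem_open (h hx) hV
    exact ⟨n, by rwa [PiNat.mem_cylinder_iff_eq.1 hxy]⟩
  choose! n hn using hcyl
  obtain ⟨t, htc⟩ := (isCompact_natBox a).elim_nhds_subcover'
    (fun x _ => PiNat.cylinder x (n x)) fun x _ =>
      (PiNat.isOpen_cylinder (fun _ : ℕ => ℕ) x (n x)).mem_nhds (PiNat.self_mem_cylinder x _)
  refine ⟨t.sup fun x => n x, fun b hb => ?_⟩
  have hmem : (fun i => min (b i) (a i)) ∈ natBox a := fun i => min_le_right _ _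
  obtain ⟨x, hx, hbx⟩ := Set.mem_iUnion₂.1 (htc hmem)
  refine hn x x.2 fun i hi => ?_
  have hik : i < t.sup fun x => n x :=
    hi.trans_le (Finset.le_sup (f := fun x : natBox a => n x) hx)
  rw [← hbx i hi]
  exact (min_eq_left (hb i hik)).symm

section Capacity

variable {Ω : Type*} [TopologicalSpace Ω] [MeasurableSpace Ω]

/-- Capacitability of continuous images of the Baire space. -/
lemma exists_natBox_le_measure {f : (ℕ → ℕ) → Ω} (hf : Continuous f) (μ : Measure Ω)
    [μ.OuterRegular] {t : ℝ≥0∞} (ht : t < μ (Set.range f)) :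
    ∃ a, t ≤ μ (f '' natBox a) := by
  have hstep : ∀ (k : ℕ) (C : Set (ℕ → ℕ)), t < μ (f '' C) →
      ∃ m : ℕ, t < μ (f '' (C ∩ {b | b k ≤ m})) := by
    intro k C hC
    have hmono : Monotone fun m : ℕ => f '' (C ∩ {b | b k ≤ m}) := fun m m' hm =>
      Set.image_mono (Set.inter_subset_inter_right _ fun b hb => le_trans hb hm)
    have hU : f '' C = ⋃ m : ℕ, f '' (C ∩ {b | b k ≤ m}) := by
      rw [← Set.image_iUnion, ← Set.inter_iUnion]
      congr 1
      refine (Set.inter_eq_left.2 fun b _ => Set.mem_iUnion.2 ⟨b k, ?_⟩).symm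
      exact le_refl (b k)
    rw [hU, hmono.measure_iUnion] at hC
    exact lt_iSup_iff.1 hC
  choose! m hm using hstep
  let C : ℕ → Set (ℕ → ℕ) := fun k =>
    Nat.rec Set.univ (fun k C => C ∩ {b | b k ≤ m k C}) k
  have hC : ∀ k, t < μ (f '' C k) := by
    intro k
    induction k with
    | zero => simpa [C] using ht
    | succ k ih => exact hm k _ ih
  have hCsub : ∀ k, C k ⊆ natBoxUpTo (fun i => m i (C i)) k := by
    intro k
    induction k with
    | zero => intro b _ i hi; omega
    | succ k ih =>
      rintro b ⟨hb, hbk⟩ i hi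
      rcases Nat.lt_succ_iff_lt_or_eq.1 hi with h | rfl
      · exact ih hb i h
      · exact hbk
  refine ⟨fun i => m i (C i), le_of_forall_gt fun r hr => ?_⟩
  obtain ⟨U, hU, hUo, hUr⟩ := Set.exists_isOpen_lt_of_lt _ _ hr
  obtain ⟨k, hk⟩ := exists_natBoxUpTo_subset (hUo.preimage hf) (Set.image_subset_iff.1 hU)
  exact (hC k).trans_le
    (measure_mono (Set.image_subset_iff.2 ((hCsub k).trans hk))) |>.trans hUr

/-- Analytic sets are universally measurable. -/
lemma nullMeasurableSet_of_analyticSet [T2Space Ω] [OpensMeasurableSpace Ω] {s : Set Ω}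
    (hs : AnalyticSet s) (μ : Measure Ω) [IsFiniteMeasure μ] [μ.OuterRegular] :
    NullMeasurableSet s μ := by
  rw [AnalyticSet] at hs
  rcases hs with rfl | ⟨f, hf, rfl⟩
  · exact MeasurableSet.empty.nullMeasurableSet
  rcases eq_or_ne (μ (Set.range f)) 0 with h0 | h0
  · exact NullMeasurableSet.of_null h0
  obtain ⟨u, -, hu, hlim⟩ := exists_seq_strictMono_tendsto' (pos_iff_ne_zero.2 h0)
  choose a ha using fun n => exists_natBox_le_measure hf μ (hu n).2
  let K := ⋃ n, f '' natBox (a n)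
  have hKm : MeasurableSet K := MeasurableSet.iUnion fun n =>
    ((isCompact_natBox (a n)).image hf).isClosed.measurableSet
  have hK : K ⊆ Set.range f := Set.iUnion_subset fun n => Set.image_subset_range _ _
  have hle : μ (Set.range f) ≤ μ K := le_of_tendsto' hlim fun n =>
    (ha n).trans (measure_mono (Set.subset_iUnion (fun n => f '' natBox (a n)) n))
  have hae : K =ᵐ[μ] Set.range f :=
    ae_eq_of_subset_of_measure_ge hK hle hKm.nullMeasurableSet (measure_ne_top _ _)
  exact hKm.nullMeasurableSet.congr hae

variable [T2Space Ω] [NormalSpace Ω] [HasOuterApproxClosed Ω] [BorelSpace Ω]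

lemma isClosed_setOf_le_measure_image_natBox {f : (ℕ → ℕ) → Ω} (hf : Continuous f)
    (hreg : ∀ μ : ProbabilityMeasure Ω, μ.toMeasure.OuterRegular) (t : ℝ≥0∞) :
    IsClosed {q : ProbabilityMeasure Ω × (ℕ → ℕ) | t ≤ q.1.toMeasure (f '' natBox q.2)} := by
  rw [← isOpen_compl_iff, isOpen_iff_mem_nhds]
  rintro ⟨μ, a⟩ hμ
  rw [Set.mem_compl_iff, Set.mem_ofPred_eq, not_le] at hμ
  have := hreg μ
  obtain ⟨U, hU, hUo, hUt⟩ := Set.exists_isOpen_lt_of_lt _ _ hμ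
  obtain ⟨W, hWo, hKW, hWU⟩ :=
    normal_exists_closure_subset ((isCompact_natBox a).image hf).isClosed hUo hU
  obtain ⟨k, hk⟩ := exists_natBoxUpTo_subset (hWo.preimage hf) (Set.image_subset_iff.1 hKW)
  have h1 : ∀ᶠ ν : ProbabilityMeasure Ω in 𝓝 μ, ν.toMeasure (closure W) < t := by
    have hlim : (𝓝 μ).limsup (fun ν : ProbabilityMeasure Ω => ν.toMeasure (closure W)) < t :=
      (ProbabilityMeasure.limsup_measure_closed_le_of_tendsto tendsto_id
        isClosed_closure).trans_lt ((measure_mono hWU).trans_lt hUt)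
    exact eventually_lt_of_limsup_lt hlim
  have h2 : ∀ᶠ b : ℕ → ℕ in 𝓝 a, ∀ i < k, b i = a i :=
    (PiNat.isOpen_cylinder (fun _ : ℕ => ℕ) a k).mem_nhds (PiNat.self_mem_cylinder a k)
  rw [nhds_prod_eq]
  filter_upwards [h1.prod_mk h2] with q hq
  rw [Set.mem_compl_iff, Set.mem_ofPred_eq, not_le]
  refine (measure_mono ?_).trans_lt hq.1
  exact (Set.image_subset_iff.2 ((natBox_subset_natBoxUpTo hq.2).trans hk)).trans subset_closure

end Capacity

lemma exists_nnrat_btwn_of_lt {a b : ℝ≥0∞} (h : a < b) :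
    ∃ q : ℚ≥0, a < ((q : ℝ≥0) : ℝ≥0∞) ∧ ((q : ℝ≥0) : ℝ≥0∞) < b := by
  obtain ⟨q, hq, h1, h2⟩ := ENNReal.lt_iff_exists_rat_btwn.1 h
  lift q to ℚ≥0 using hq
  have hq : Real.toNNReal ((q : ℚ) : ℝ) = (q : ℝ≥0) := by
    ext
    rw [Real.coe_toNNReal _ (by positivity)]
    norm_cast
  exact ⟨q, hq ▸ h1, hq ▸ h2⟩

lemma analyticSet_iInter_of_univ {γ ι : Type*} [TopologicalSpace γ] [T2Space γ] [Countable ι]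
    (hu : AnalyticSet (Set.univ : Set γ)) {s : ι → Set γ} (hs : ∀ i, AnalyticSet (s i)) :
    AnalyticSet (⋂ i, s i) := by
  cases isEmpty_or_nonempty ι
  · simpa using hu
  · exact AnalyticSet.iInter hs

lemma analyticSet_const {γ : Type*} [TopologicalSpace γ] (hu : AnalyticSet (Set.univ : Set γ))
    (P : Prop) : AnalyticSet {_x : γ | P} := by
  by_cases h : P
  · simpa [h] using hu
  · simpa [h] using analyticSet_empty

/-- Projections of closed sets along a Polish factor are analytic. -/
lemma analyticSet_exists_of_isClosed {γ δ : Type*} [TopologicalSpace γ] [TopologicalSpace δ]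
    [PolishSpace δ] (hu : AnalyticSet (Set.univ : Set γ)) {F : Set (γ × δ)} (hF : IsClosed F) :
    AnalyticSet {x | ∃ y, (x, y) ∈ F} := by
  obtain ⟨β, _, _, g, hg, hgr⟩ := analyticSet_iff_exists_polishSpace_range.1 hu
  have hcl : IsClosed {q : β × δ | (g q.1, q.2) ∈ F} :=
    hF.preimage ((hg.comp continuous_fst).prodMk continuous_snd)
  convert hcl.analyticSet.image_of_continuous (hg.comp continuous_fst)
  ext x
  constructor
  · rintro ⟨y, hy⟩
    obtain ⟨b, rfl⟩ : x ∈ Set.range g := hgr ▸ Set.mem_univ x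
    exact ⟨(b, y), hy, rfl⟩
  · rintro ⟨⟨b, y⟩, hq, rfl⟩
    exact ⟨y, hq⟩

lemma analyticSet_setOf_lt_measure_of_univ {Ω : Type*} [TopologicalSpace Ω]
    [MeasurableSpace Ω] [BorelSpace Ω] [TopologicalSpace.MetrizableSpace Ω]
    (hu : AnalyticSet (Set.univ : Set (ProbabilityMeasure Ω))) {s : Set Ω} (hs : AnalyticSet s)
    (t : ℝ≥0∞) : AnalyticSet {p : ProbabilityMeasure Ω | t < p.toMeasure s} := by
  let : MetricSpace Ω := TopologicalSpace.metrizableSpaceMetric Ω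
  rw [AnalyticSet] at hs
  rcases hs with rfl | ⟨f, hf, rfl⟩
  · simpa using analyticSet_empty
  have key : {p : ProbabilityMeasure Ω | t < p.toMeasure (Set.range f)} =
      ⋃ q : {q : ℚ≥0 // t < ((q : ℝ≥0) : ℝ≥0∞)}, {p : ProbabilityMeasure Ω | ∃ a,
        (p, a) ∈ {q' : ProbabilityMeasure Ω × (ℕ → ℕ) |
          ((q.1 : ℝ≥0) : ℝ≥0∞) ≤ q'.1.toMeasure (f '' natBox q'.2)}} := by
    ext p
    simp only [Set.mem_ofPred_eq, Set.mem_iUnion, Subtype.exists, exists_prop]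
    constructor
    · intro h
      obtain ⟨q, htq, hq⟩ := exists_nnrat_btwn_of_lt h
      exact ⟨q, htq, exists_natBox_le_measure hf _ hq⟩
    · rintro ⟨q, hq, a, ha⟩
      exact hq.trans_le (ha.trans (measure_mono (Set.image_subset_range _ _)))
  rw [key]
  exact AnalyticSet.iUnion fun q => analyticSet_exists_of_isClosed hu
    (isClosed_setOf_le_measure_image_natBox hf (fun _ => inferInstance) _)

lemma analyticSet_setOf_le_measure_of_univ {Ω : Type*} [TopologicalSpace Ω]
    [MeasurableSpace Ω] [BorelSpace Ω] [TopologicalSpace.MetrizableSpace Ω]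
    (hu : AnalyticSet (Set.univ : Set (ProbabilityMeasure Ω))) {s : Set Ω} (hs : AnalyticSet s)
    (t : ℝ≥0∞) : AnalyticSet {p : ProbabilityMeasure Ω | t ≤ p.toMeasure s} := by
  let : MetricSpace Ω := TopologicalSpace.metrizableSpaceMetric Ω
  have key : {p : ProbabilityMeasure Ω | t ≤ p.toMeasure s} =
      ⋂ q : {q : ℚ≥0 // ((q : ℝ≥0) : ℝ≥0∞) < t},
        {p : ProbabilityMeasure Ω | ((q.1 : ℝ≥0) : ℝ≥0∞) < p.toMeasure s} := by
    ext p
    simp only [Set.mem_ofPred_eq, Set.mem_iInter, Subtype.forall]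
    refine ⟨fun h q hq => hq.trans_le h, fun h => le_of_not_gt fun hlt => ?_⟩
    obtain ⟨q, h1, h2⟩ := exists_nnrat_btwn_of_lt hlt
    exact (h q h2).not_gt h1
  rw [key]
  exact analyticSet_iInter_of_univ hu fun q => analyticSet_setOf_lt_measure_of_univ hu hs _

/-- The space of Borel probability measures on a Polish space is analytic. -/
lemma analyticSet_univ_probabilityMeasure_s10 {Ω : Type*} [TopologicalSpace Ω] [PolishSpace Ω]
    [MeasurableSpace Ω] [BorelSpace Ω] :
    AnalyticSet (Set.univ : Set (ProbabilityMeasure Ω)) := by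
  let : MetricSpace Ω := TopologicalSpace.metrizableSpaceMetric Ω
  obtain ⟨F, hF⟩ := Metric.PiNatEmbed.exists_embedding_to_hilbert_cube (X := Ω)
  have : PolishSpace (ProbabilityMeasure (ℕ → unitInterval)) := by
    let := TopologicalSpace.metrizableSpaceMetric (ProbabilityMeasure (ℕ → unitInterval))
    infer_instance
  have hu : AnalyticSet (Set.univ : Set (ProbabilityMeasure (ℕ → unitInterval))) :=
    isClosed_univ.analyticSet
  have hFm : MeasurableEmbedding F := hF.continuous.measurableEmbedding hF.injective
  have hE := analyticSet_setOf_le_measure_of_univ hu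
    (analyticSet_range_of_polishSpace hF.continuous) 1
  obtain ⟨β, _, _, g, hg, hgr⟩ := analyticSet_iff_exists_polishSpace_range.1 hE
  let : MetricSpace β := TopologicalSpace.metrizableSpaceMetric β
  have hlift : ∀ b, ∃ p : ProbabilityMeasure Ω, p.toMeasure.map F = (g b).toMeasure := by
    intro b
    have hb : 1 ≤ (g b).toMeasure (Set.range F) := by
      have : g b ∈ Set.range g := ⟨b, rfl⟩
      rwa [hgr] at this
    have hb1 : (g b).toMeasure (Set.range F) = 1 := le_antisymm prob_le_one hb
    refine ⟨⟨(g b).toMeasure.comap F, ⟨?_⟩⟩, ?_⟩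
    · rw [hFm.comap_apply, Set.image_univ, hb1]
    · change ((g b).toMeasure.comap F).map F = _
      rw [hFm.map_comap, Measure.restrict_eq_self_of_ae_mem]
      exact (prob_compl_eq_zero_iff hFm.measurableSet_range).2 hb1
  choose h hh using hlift
  have hcont : Continuous h := by
    refine continuous_iff_continuousAt.2 fun b => ?_
    refine tendsto_of_forall_isOpen_le_liminf' fun G hG => ?_
    obtain ⟨U, hU, rfl⟩ := hF.isOpen_iff.1 hG
    simp only [← Measure.map_apply hF.continuous.measurable hU.measurableSet, hh]
    exact ProbabilityMeasure.le_liminf_measure_open_of_tendsto (hg.tendsto b) hU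
  have hsurj : Set.range h = Set.univ := by
    refine Set.eq_univ_of_forall fun p => ?_
    have hp : p.map hFm.measurable.aemeasurable ∈ Set.range g := by
      rw [hgr]
      change 1 ≤ (p.toMeasure.map F) (Set.range F)
      rw [Measure.map_apply hFm.measurable hFm.measurableSet_range]
      simp
    obtain ⟨b, hb⟩ := hp
    refine ⟨b, Subtype.ext ?_⟩
    have : (h b).toMeasure.map F = p.toMeasure.map F := by
      rw [hh, hb]
      rfl
    calc (h b).toMeasure = ((h b).toMeasure.map F).comap F := (hFm.comap_map _).symm
      _ = p.toMeasure := by rw [this, hFm.comap_map]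
  exact hsurj ▸ analyticSet_range_of_polishSpace hcont

section ENNReal

variable {γ : Type*} [TopologicalSpace γ] {f g : γ → ℝ≥0∞}

lemma analyticSet_lt_iff_le [T2Space γ] (hu : AnalyticSet (Set.univ : Set γ)) :
    (∀ r, AnalyticSet {x | f x < r}) ↔ ∀ r, AnalyticSet {x | f x ≤ r} := by
  constructor
  · intro h r
    have key : {x | f x ≤ r} =
        ⋂ q : {q : ℚ≥0 // r < ((q : ℝ≥0) : ℝ≥0∞)}, {x | f x < ((q.1 : ℝ≥0) : ℝ≥0∞)} := by
      ext x
      simp only [Set.mem_ofPred_eq, Set.mem_iInter, Subtype.forall]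
      refine ⟨fun hx q hq => hx.trans_lt hq, fun hx => le_of_not_gt fun hlt => ?_⟩
      obtain ⟨q, h1, h2⟩ := exists_nnrat_btwn_of_lt hlt
      exact (hx q h1).not_gt h2
    rw [key]
    exact analyticSet_iInter_of_univ hu fun q => h _
  · intro h r
    have key : {x | f x < r} =
        ⋃ q : {q : ℚ≥0 // ((q : ℝ≥0) : ℝ≥0∞) < r}, {x | f x ≤ ((q.1 : ℝ≥0) : ℝ≥0∞)} := by
      ext x
      simp only [Set.mem_ofPred_eq, Set.mem_iUnion, Subtype.exists, exists_prop]
      refine ⟨fun hx => ?_, fun ⟨q, hq, hx⟩ => hx.trans_lt hq⟩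
      obtain ⟨q, h1, h2⟩ := exists_nnrat_btwn_of_lt hx
      exact ⟨q, h2, h1.le⟩
    rw [key]
    exact AnalyticSet.iUnion fun q => h _

lemma analyticSet_inter [T2Space γ] {s t : Set γ} (hs : AnalyticSet s) (ht : AnalyticSet t) :
    AnalyticSet (s ∩ t) := by
  rw [Set.inter_eq_iInter]
  exact AnalyticSet.iInter fun b => by cases b <;> assumption

lemma analyticSet_add_lt [T2Space γ] (hf : ∀ r, AnalyticSet {x | f x < r})
    (hg : ∀ r, AnalyticSet {x | g x < r}) (r : ℝ≥0∞) : AnalyticSet {x | f x + g x < r} := by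
  have key : {x | f x + g x < r} = ⋃ q : ℚ≥0,
      {x | f x < ((q : ℝ≥0) : ℝ≥0∞)} ∩ {x | g x < r - ((q : ℝ≥0) : ℝ≥0∞)} := by
    ext x
    simp only [Set.mem_ofPred_eq, Set.mem_iUnion, Set.mem_inter_iff, lt_tsub_iff_left]
    constructor
    · intro h
      have hg : g x ≠ ⊤ := fun h' => by simp [h'] at h
      obtain ⟨q, h1, h2⟩ := exists_nnrat_btwn_of_lt (lt_tsub_iff_right.2 h)
      exact ⟨q, h1, lt_tsub_iff_right.1 h2⟩
    · rintro ⟨q, h1, h2⟩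
      exact (add_le_add_left h1.le _).trans_lt h2
  rw [key]
  exact AnalyticSet.iUnion fun q => analyticSet_inter (hf _) (hg _)

lemma analyticSet_mul_lt (hu : AnalyticSet (Set.univ : Set γ))
    (hf : ∀ r, AnalyticSet {x | f x < r}) {a : ℝ≥0∞} (ha : a ≠ ⊤) (r : ℝ≥0∞) :
    AnalyticSet {x | a * f x < r} := by
  rcases eq_or_ne a 0 with rfl | h0
  · simpa using analyticSet_const hu (0 < r)
  · simpa only [mul_comm a, ENNReal.lt_div_iff_mul_lt (Or.inl h0) (Or.inl ha)] using hf (r / a)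

end ENNReal

/-- The largest threshold in `s` lying strictly below `x`, or `0` if there is none. -/
def lowerStep (s : Finset ℚ≥0) (x : ℝ≥0∞) : ℝ≥0∞ :=
  s.sup fun q => (Set.Ioi ((q : ℝ≥0) : ℝ≥0∞)).indicator (fun _ => ((q : ℝ≥0) : ℝ≥0∞)) x

lemma measurable_lowerStep (s : Finset ℚ≥0) : Measurable fun x => lowerStep s x := by
  simp only [lowerStep, Finset.sup_eq_iSup]
  exact Measurable.biSup _ s.countable_toSet fun q _ =>
    measurable_const.indicator measurableSet_Ioi

lemma lowerStep_mono {s t : Finset ℚ≥0} (h : s ⊆ t) (x : ℝ≥0∞) : lowerStep s x ≤ lowerStep t x :=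
  Finset.sup_mono h

lemma iSup_lowerStep (x : ℝ≥0∞) : ⨆ s, lowerStep s x = x := by
  refine le_antisymm (iSup_le fun s => Finset.sup_le fun q _ => ?_) (le_of_forall_lt fun y hy => ?_)
  · exact Set.indicator_apply_le' (fun h => le_of_lt h) fun _ => zero_le
  · obtain ⟨q, h1, h2⟩ := exists_nnrat_btwn_of_lt hy
    refine h1.trans_le (le_iSup_of_le {q} ?_)
    rw [lowerStep, Finset.sup_singleton, Set.indicator_of_mem (Set.mem_Ioi.2 h2)]

lemma lowerStep_insert {a : ℚ≥0} {s : Finset ℚ≥0} (h : ∀ q ∈ s, q < a) (x : ℝ≥0∞) :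
    lowerStep (insert a s) x = lowerStep s x +
      (Set.Ioi ((a : ℝ≥0) : ℝ≥0∞)).indicator
        (fun _ => ((a : ℝ≥0) : ℝ≥0∞) - s.sup fun q : ℚ≥0 => ((q : ℝ≥0) : ℝ≥0∞)) x := by
  have hle : (s.sup fun q : ℚ≥0 => ((q : ℝ≥0) : ℝ≥0∞)) ≤ ((a : ℝ≥0) : ℝ≥0∞) :=
    Finset.sup_le fun q hq => by exact_mod_cast (h q hq).le
  by_cases hx : ((a : ℝ≥0) : ℝ≥0∞) < x
  · have hs : lowerStep s x = s.sup fun q : ℚ≥0 => ((q : ℝ≥0) : ℝ≥0∞) := by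
      refine Finset.sup_congr rfl fun q hq => Set.indicator_of_mem (Set.mem_Ioi.2 ?_) _
      refine lt_of_le_of_lt ?_ hx
      exact_mod_cast (h q hq).le
    have hs' : lowerStep (insert a s) x = ((a : ℝ≥0) : ℝ≥0∞) ⊔ lowerStep s x := by
      rw [lowerStep, Finset.sup_insert, Set.indicator_of_mem (Set.mem_Ioi.2 hx)]
      rfl
    rw [hs', Set.indicator_of_mem (Set.mem_Ioi.2 hx), hs, add_tsub_cancel_of_le hle,
      sup_eq_left.2 hle]
  · rw [Set.indicator_of_notMem (by simpa using hx), add_zero, lowerStep, Finset.sup_insert,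
      Set.indicator_of_notMem (by simpa using hx)]
    exact bot_sup_eq _

section Integral

variable {Ω : Type*} [TopologicalSpace Ω] [PolishSpace Ω] [MeasurableSpace Ω] [BorelSpace Ω]

lemma analyticSet_measure_compl_lt {s : Set Ω} (hs : AnalyticSet s) (r : ℝ≥0∞) :
    AnalyticSet {p : ProbabilityMeasure Ω | p.toMeasure sᶜ < r} := by
  let : MetricSpace Ω := TopologicalSpace.metrizableSpaceMetric Ω
  have hu := analyticSet_univ_probabilityMeasure_s10 (Ω := Ω)
  have hc (p : ProbabilityMeasure Ω) : p.toMeasure sᶜ = 1 - p.toMeasure s :=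
    prob_compl_eq_one_sub₀ (nullMeasurableSet_of_analyticSet hs _)
  simp only [hc]
  rcases le_or_gt r 1 with hr | hr
  · have key (p : ProbabilityMeasure Ω) :
        1 - p.toMeasure s < r ↔ 1 - r < p.toMeasure s := by
      rw [ENNReal.sub_lt_iff_lt_right (measure_ne_top _ _) prob_le_one,
        ENNReal.sub_lt_iff_lt_right (hr.trans_lt ENNReal.one_lt_top).ne hr, add_comm]
    simpa only [key] using analyticSet_setOf_lt_measure_of_univ hu hs _
  · convert hu
    ext p
    simpa using tsub_le_self.trans_lt hr

lemma aemeasurable_of_analyticSet_le {f : Ω → ℝ≥0∞} (hf : ∀ r, AnalyticSet {x | f x ≤ r})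
    (μ : Measure Ω) [IsFiniteMeasure μ] : AEMeasurable f μ := by
  let : MetricSpace Ω := TopologicalSpace.metrizableSpaceMetric Ω
  have : NullMeasurable f μ := @measurable_of_Iic ℝ≥0∞ (NullMeasurableSpace Ω μ) _ _ _ _ _ _ _ _
    fun r => nullMeasurableSet_of_analyticSet (hf r) μ
  exact this.aemeasurable

lemma analyticSet_lintegral_lowerStep_lt {f : Ω → ℝ≥0∞} (hf : ∀ r, AnalyticSet {x | f x ≤ r})
    (s : Finset ℚ≥0) : ∀ r, AnalyticSet
      {p : ProbabilityMeasure Ω | ∫⁻ x, lowerStep s (f x) ∂p.toMeasure < r} := by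
  have hu := analyticSet_univ_probabilityMeasure_s10 (Ω := Ω)
  let : MetricSpace Ω := TopologicalSpace.metrizableSpaceMetric Ω
  induction s using Finset.induction_on_max with
  | empty =>
    intro r
    simpa [lowerStep] using analyticSet_const hu (0 < r)
  | insert a s h ih =>
    set d : ℝ≥0∞ := ((a : ℝ≥0) : ℝ≥0∞) - s.sup fun q : ℚ≥0 => ((q : ℝ≥0) : ℝ≥0∞)
    have hd : d ≠ ⊤ := ENNReal.sub_ne_top ENNReal.coe_ne_top
    have key (p : ProbabilityMeasure Ω) : ∫⁻ x, lowerStep (insert a s) (f x) ∂p.toMeasure =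
        ∫⁻ x, lowerStep s (f x) ∂p.toMeasure +
          d * p.toMeasure {x | f x ≤ ((a : ℝ≥0) : ℝ≥0∞)}ᶜ := by
      have hfm := aemeasurable_of_analyticSet_le hf p.toMeasure
      simp only [lowerStep_insert h]
      rw [lintegral_add_left' (f := fun x => lowerStep s (f x))
        ((measurable_lowerStep s).comp_aemeasurable hfm)]
      congr 1
      have hset : {x | f x ≤ ((a : ℝ≥0) : ℝ≥0∞)}ᶜ = f ⁻¹' Set.Ioi ((a : ℝ≥0) : ℝ≥0∞) := by
        ext x; simp
      rw [hset, ← lintegral_indicator_const₀ (hfm.nullMeasurableSet_preimage measurableSet_Ioi)]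
      rfl
    simp only [key]
    exact analyticSet_add_lt ih (analyticSet_mul_lt hu (analyticSet_measure_compl_lt (hf _)) hd)

/-- Integration preserves lower semianalyticity of nonnegative functions. -/
lemma analyticSet_lintegral_lt {f : Ω → ℝ≥0∞} (hf : ∀ r, AnalyticSet {x | f x ≤ r}) :
    ∀ r, AnalyticSet {p : ProbabilityMeasure Ω | ∫⁻ x, f x ∂p.toMeasure < r} := by
  have hu := analyticSet_univ_probabilityMeasure_s10 (Ω := Ω)
  let : MetricSpace Ω := TopologicalSpace.metrizableSpaceMetric Ω
  refine (analyticSet_lt_iff_le hu).2 fun r => ?_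
  have key (p : ProbabilityMeasure Ω) : ∫⁻ x, f x ∂p.toMeasure =
      ⨆ s, ∫⁻ x, lowerStep s (f x) ∂p.toMeasure := by
    have hfm := aemeasurable_of_analyticSet_le hf p.toMeasure
    rw [← lintegral_iSup_directed (f := fun s x => lowerStep s (f x))
      fun s => (measurable_lowerStep s).comp_aemeasurable hfm]
    · simp only [iSup_lowerStep]
    · intro s t
      exact ⟨s ∪ t, fun x => lowerStep_mono Finset.subset_union_left _,
        fun x => lowerStep_mono Finset.subset_union_right _⟩
  simp only [key, iSup_le_iff, Set.ofPred_forall]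
  exact AnalyticSet.iInter fun s =>
    (analyticSet_lt_iff_le hu).1 (analyticSet_lintegral_lowerStep_lt hf s) r

end Integral

lemma ePos_le_coe_iff {y : EReal} {r : ℝ≥0} : ePos y ≤ (r : ℝ≥0∞) ↔ y ≤ ((r : ℝ) : EReal) := by
  induction y with
  | bot => simp [ePos]
  | top => simp [ePos]
  | coe x => simp [ePos, ENNReal.ofReal, Real.toNNReal_le_iff_le_coe]

lemma esum_coe {n : ℕ} (x : Fin n → ℝ) :
    esum (fun i => (x i : EReal)) = ((∑ i, x i : ℝ) : EReal) := by
  have hsum (y : Fin n → ℝ) :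
      ∑ i, ePos (y i : EReal) = ENNReal.ofReal (∑ i, max (y i) 0) := by
    rw [ENNReal.ofReal_sum_of_nonneg fun i _ => le_max_right _ _]
    refine Finset.sum_congr rfl fun i _ => ?_
    rcases le_total 0 (y i) with h | h <;> simp [ePos, h, ENNReal.ofReal_of_nonpos]
  have hnn (y : Fin n → ℝ) : 0 ≤ ∑ i, max (y i) 0 :=
    Finset.sum_nonneg fun i _ => le_max_right _ _
  have hneg : ∑ i, ePos (-(x i : EReal)) = ENNReal.ofReal (∑ i, max (-x i) 0) := by
    simpa using hsum fun i => -x i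
  rw [esum, hsum, hneg, if_neg ENNReal.ofReal_ne_top, EReal.coe_ennreal_ofReal,
    EReal.coe_ennreal_ofReal, max_eq_left (hnn x), max_eq_left (hnn fun i => -x i),
    ← EReal.coe_sub, ← Finset.sum_sub_distrib]
  congr 2 with i
  rcases le_total 0 (x i) with h | h <;> simp [h]

lemma esum_eq_top {n : ℕ} {v : Fin n → EReal} {i : Fin n} (h : v i = ⊤) : esum v = ⊤ :=
  if_pos <| ENNReal.sum_eq_top.2 ⟨i, Finset.mem_univ i, by simp [ePos, h]⟩

lemma esum_lt_iff {n : ℕ} {v : Fin n → EReal} (hv : ∀ i, v i ≠ ⊥) {r : ℝ} :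
    esum v < (r : EReal) ↔
      ∃ q : Fin n → ℚ, (∑ i, (q i : ℝ)) < r ∧ ∀ i, v i < ((q i : ℝ) : EReal) := by
  constructor
  · intro h
    have htop : ∀ i, v i ≠ ⊤ := fun i hi => by simp [esum_eq_top hi] at h
    have hx : v = fun i => ((v i).toReal : EReal) :=
      funext fun i => (EReal.coe_toReal (htop i) (hv i)).symm
    rw [hx, esum_coe, EReal.coe_lt_coe_iff] at h
    set d := (r - ∑ i, (v i).toReal) / (n + 1)
    have hd : 0 < d := div_pos (sub_pos.2 h) (by positivity)
    choose q hq1 hq2 using fun i => exists_rat_btwn (lt_add_of_pos_right (v i).toReal hd)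
    refine ⟨q, ?_, fun i => ?_⟩
    · calc ∑ i, (q i : ℝ) ≤ ∑ i, ((v i).toReal + d) := Finset.sum_le_sum fun i _ => (hq2 i).le
        _ = ∑ i, (v i).toReal + n * d := by simp [Finset.sum_add_distrib]
        _ < ∑ i, (v i).toReal + (n + 1) * d := by linarith
        _ = r := by simp only [d]; field_simp; ring
    · rw [← EReal.coe_toReal (htop i) (hv i), EReal.coe_lt_coe_iff]
      exact hq1 i
  · rintro ⟨q, hq, hvq⟩
    have hx : v = fun i => ((v i).toReal : EReal) :=
      funext fun i => (EReal.coe_toReal (hvq i).ne_top (hv i)).symm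
    rw [hx, esum_coe, EReal.coe_lt_coe_iff]
    refine (Finset.sum_le_sum fun i _ => ?_).trans_lt hq
    have := hvq i
    rw [← EReal.coe_toReal (hvq i).ne_top (hv i), EReal.coe_lt_coe_iff] at this
    exact this.le

lemma avg_succ_le_iff (n : ℕ) (y : EReal) (r : ℝ) :
    avg (n + 1) y ≤ (r : EReal) ↔ y ≤ (((n + 1) * r : ℝ) : EReal) := by
  have hn : (0 : ℝ) < ((n + 1 : ℕ) : ℝ)⁻¹ := by positivity
  induction y with
  | bot => rw [avg, EReal.coe_mul_bot_of_pos hn]; simp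
  | top =>
    rw [avg, EReal.coe_mul_top_of_pos hn]
    exact iff_of_false (EReal.coe_lt_top _).not_ge (EReal.coe_lt_top _).not_ge
  | coe x =>
    rw [avg, ← EReal.coe_mul, EReal.coe_le_coe_iff, EReal.coe_le_coe_iff,
      inv_mul_le_iff₀ (by positivity)]
    push_cast
    rfl

lemma real_add_coe_ennreal_lt_iff {z r : ℝ} {y : ℝ≥0∞} :
    (z : EReal) + (y : EReal) < (r : EReal) ↔ y < ENNReal.ofReal (r - z) := by
  induction y with
  | top => simp
  | coe y =>
    have : ((y : ℝ≥0∞) : EReal) = ((y : ℝ) : EReal) := rfl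
    rw [this, ← EReal.coe_add, EReal.coe_lt_coe_iff, ENNReal.lt_ofReal_iff_toReal_lt
      ENNReal.coe_ne_top, ENNReal.coe_toReal, lt_sub_iff_add_lt']

lemma ePos_mono : Monotone ePos := by
  intro y z h
  rcases eq_or_ne z ⊤ with rfl | hz
  · simp [ePos]
  have hy : y ≠ ⊤ := (h.trans_lt hz.lt_top).ne
  rw [ePos, ePos, if_neg hy, if_neg hz]
  induction y with
  | top => exact absurd rfl hy
  | bot => simp
  | coe y => exact ENNReal.ofReal_le_ofReal (EReal.toReal_le_toReal h (by simp) hz)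

lemma Rcvar_eq_iInf_rat {X A : Type*} [MeasurableSpace X] [MeasurableSpace A] (c : X × A → EReal)
    (α : ℝ) (p : ProbabilityMeasure (Traj X A)) :
    Rcvar c α p = ⨅ z : ℚ, (((z : ℝ) : EReal) + (((ENNReal.ofReal α)⁻¹ *
      ∫⁻ ω, ePos (cbar c ω - ((z : ℝ) : EReal)) ∂p.toMeasure : ℝ≥0∞) : EReal)) := by
  refine le_antisymm (le_iInf fun z => iInf_le _ (z : ℝ)) (le_iInf fun z => ?_)
  refine le_of_forall_gt fun r hr => iInf_lt_iff.2 ?_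
  have hmono (q : ℝ) (hq : z ≤ q) : (ENNReal.ofReal α)⁻¹ *
      ∫⁻ ω, ePos (cbar c ω - (q : EReal)) ∂p.toMeasure ≤ (ENNReal.ofReal α)⁻¹ *
      ∫⁻ ω, ePos (cbar c ω - (z : EReal)) ∂p.toMeasure := by
    gcongr with ω
    exact ePos_mono (EReal.sub_le_sub le_rfl (EReal.coe_le_coe_iff.2 hq))
  generalize (ENNReal.ofReal α)⁻¹ * ∫⁻ ω, ePos (cbar c ω - (z : EReal)) ∂p.toMeasure = y
    at hr hmono
  induction y with
  | top => simp at hr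
  | coe y =>
    have hy : ((y : ℝ≥0∞) : EReal) = ((y : ℝ) : EReal) := rfl
    rw [hy, ← EReal.lt_sub_iff_add_lt (by simp) (by simp)] at hr
    obtain ⟨q, h1, h2⟩ := EReal.exists_rat_btwn_of_lt hr
    refine ⟨q, lt_of_le_of_lt (add_le_add_right (EReal.coe_ennreal_le_coe_ennreal_iff.2
      (hmono q (EReal.coe_lt_coe_iff.1 h1).le)) _) ?_⟩
    rwa [hy, ← EReal.lt_sub_iff_add_lt (by simp) (by simp)]

section LowerSemianalytic

variable {γ : Type*} [TopologicalSpace γ]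

lemma LowerSemianalytic.analyticSet_lt {f : γ → EReal} (hf : LowerSemianalytic f) (r : ℝ) :
    AnalyticSet {x | f x < (r : EReal)} := by
  have key : {x | f x < (r : EReal)} = ⋃ q : {q : ℚ // (q : ℝ) < r},
      {x | f x ≤ ((q.1 : ℝ) : EReal)} := by
    ext x
    simp only [Set.mem_ofPred_eq, Set.mem_iUnion, Subtype.exists, exists_prop]
    constructor
    · intro h
      obtain ⟨q, h1, h2⟩ := EReal.exists_rat_btwn_of_lt h
      exact ⟨q, EReal.coe_lt_coe_iff.1 h2, h1.le⟩
    · rintro ⟨q, hq, h⟩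
      exact h.trans_lt (EReal.coe_lt_coe_iff.2 hq)
  rw [key]
  exact AnalyticSet.iUnion fun q => hf _

lemma lowerSemianalytic_of_lt [T2Space γ] {f : γ → EReal}
    (hf : ∀ r : ℝ, AnalyticSet {x | f x < (r : EReal)}) : LowerSemianalytic f := by
  intro r
  have key : {x | f x ≤ (r : EReal)} = ⋂ q : {q : ℚ // r < (q : ℝ)},
      {x | f x < ((q.1 : ℝ) : EReal)} := by
    ext x
    simp only [Set.mem_ofPred_eq, Set.mem_iInter, Subtype.forall]
    refine ⟨fun h q hq => h.trans_lt (EReal.coe_lt_coe_iff.2 hq),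
      fun h => le_of_not_gt fun hlt => ?_⟩
    obtain ⟨q, h1, h2⟩ := EReal.exists_rat_btwn_of_lt hlt
    exact (h q (EReal.coe_lt_coe_iff.1 h1)).not_gt h2
  have : Nonempty {q : ℚ // r < (q : ℝ)} := (exists_rat_gt r).elim fun q hq => ⟨⟨q, hq⟩⟩
  rw [key]
  exact AnalyticSet.iInter fun q => hf _

variable [T2Space γ] {ι : Type*} [Countable ι] {f : ι → γ → EReal}

lemma LowerSemianalytic.iInf (hf : ∀ i, LowerSemianalytic (f i)) :
    LowerSemianalytic fun x => ⨅ i, f i x := by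
  refine lowerSemianalytic_of_lt fun r => ?_
  simp only [iInf_lt_iff, Set.ofPred_exists]
  exact AnalyticSet.iUnion fun i => (hf i).analyticSet_lt r

lemma LowerSemianalytic.iSup [Nonempty ι] (hf : ∀ i, LowerSemianalytic (f i)) :
    LowerSemianalytic fun x => ⨆ i, f i x := by
  intro r
  simp only [iSup_le_iff, Set.ofPred_forall]
  exact AnalyticSet.iInter fun i => hf i r

end LowerSemianalytic

section AverageCost

variable {X A : Type*} [TopologicalSpace X] [PolishSpace X] [TopologicalSpace A] [PolishSpace A]
  {c : X × A → EReal}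

lemma lowerSemianalytic_pathSum (hc : LowerSemianalytic c) (hbot : ∀ y, c y ≠ ⊥) (n j : ℕ) :
    LowerSemianalytic (pathSum c n j) := by
  refine lowerSemianalytic_of_lt fun r => ?_
  have key : {ω : Traj X A | pathSum c n j ω < (r : EReal)} =
      ⋃ q : {q : Fin n → ℚ // (∑ i, (q i : ℝ)) < r}, ⋂ i : Fin n,
        (fun ω : Traj X A => ω (i.val + j)) ⁻¹' {y | c y < ((q.1 i : ℝ) : EReal)} := by
    ext ω
    simp only [pathSum, Set.mem_ofPred_eq, Set.mem_iUnion, Set.mem_iInter, Set.mem_preimage,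
      esum_lt_iff fun i : Fin n => hbot (ω (i.val + j)), Subtype.exists, exists_prop]
  rw [key]
  exact AnalyticSet.iUnion fun q => analyticSet_iInter_of_univ isClosed_univ.analyticSet fun i =>
    (hc.analyticSet_lt _).preimage (continuous_apply _)

lemma lowerSemianalytic_cbar (hc : LowerSemianalytic c) (hbot : ∀ y, c y ≠ ⊥) :
    LowerSemianalytic (cbar c) := by
  have key : cbar c = fun ω => ⨅ n : ℕ, ⨆ i : ℕ,
      avg (i + n + 1) (pathSum c (i + n + 1) 0 ω) := by
    ext ω
    rw [cbar, ← limsup_nat_add _ 1, limsup_eq_iInf_iSup_of_nat']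
  rw [key]
  refine LowerSemianalytic.iInf fun n => LowerSemianalytic.iSup fun i r => ?_
  simp only [avg_succ_le_iff]
  exact lowerSemianalytic_pathSum hc hbot _ _ _

variable [MeasurableSpace X] [BorelSpace X] [MeasurableSpace A] [BorelSpace A]

lemma lowerSemianalytic_Rcvar (hc : LowerSemianalytic c) (hbot : ∀ y, c y ≠ ⊥) {α : ℝ}
    (hα : 0 < α) : LowerSemianalytic (Rcvar c α) := by
  let : MetricSpace (Traj X A) := TopologicalSpace.metrizableSpaceMetric _
  have hu := analyticSet_univ_probabilityMeasure_s10 (Ω := Traj X A)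
  have hcbar := lowerSemianalytic_cbar hc hbot
  rw [funext (Rcvar_eq_iInf_rat c α)]
  refine LowerSemianalytic.iInf fun z => lowerSemianalytic_of_lt fun r => ?_
  simp only [real_add_coe_ennreal_lt_iff]
  refine analyticSet_mul_lt hu (analyticSet_lintegral_lt fun s => ?_)
    (ENNReal.inv_ne_top.2 (ENNReal.ofReal_pos.2 hα).ne') _
  induction s with
  | top => simpa using isClosed_univ.analyticSet
  | coe s =>
    convert hcbar (s + z) using 1
    ext ω
    rw [Set.mem_ofPred_eq, Set.mem_ofPred_eq, ePos_le_coe_iff,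
      EReal.sub_le_iff_le_add (by simp) (by simp), EReal.coe_add]

lemma lowerSemianalytic_Rvar (hc : LowerSemianalytic c) (hbot : ∀ y, c y ≠ ⊥) (α : ℝ) :
    LowerSemianalytic (Rvar c α) := by
  let : MetricSpace (Traj X A) := TopologicalSpace.metrizableSpaceMetric _
  have hu := analyticSet_univ_probabilityMeasure_s10 (Ω := Traj X A)
  refine lowerSemianalytic_of_lt fun r => ?_
  have key : {p : ProbabilityMeasure (Traj X A) | Rvar c α p < (r : EReal)} =
      ⋃ q : {q : ℚ // (q : ℝ) < r}, {p : ProbabilityMeasure (Traj X A) |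
        1 - ENNReal.ofReal α ≤ p.toMeasure {ω | cbar c ω ≤ ((q.1 : ℝ) : EReal)}} := by
    ext p
    simp only [Rvar, Set.mem_ofPred_eq, iInf_lt_iff, Set.mem_iUnion, Subtype.exists, exists_prop]
    constructor
    · rintro ⟨z, hz, hzr⟩
      obtain ⟨q, h1, h2⟩ := exists_rat_btwn (EReal.coe_lt_coe_iff.1 hzr)
      exact ⟨q, h2, hz.trans (measure_mono fun ω hω =>
        le_trans hω (EReal.coe_le_coe_iff.2 h1.le))⟩
    · rintro ⟨q, hq, h⟩
      exact ⟨q, h, EReal.coe_lt_coe_iff.2 hq⟩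
  rw [key]
  exact AnalyticSet.iUnion fun q =>
    analyticSet_setOf_le_measure_of_univ hu (lowerSemianalytic_cbar hc hbot _) _

end AverageCost

/-- second part of Lemma `lem-risk-lsa`: for `c` lower semianalytic and
real-valued on `Γ` (equal to `+∞` off `Γ`) and `α ∈ (0,1]`, the `CVaR_α` and `VaR_α`
functionals of the pathwise average cost are lower semianalytic on `P(Ω)`. -/
theorem statement10
    {X A : Type*} [TopologicalSpace X] [PolishSpace X] [MeasurableSpace X] [BorelSpace X]
    [TopologicalSpace A] [PolishSpace A] [MeasurableSpace A] [BorelSpace A]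
    (Γ : Set (X × A)) (hΓ : MeasureTheory.AnalyticSet Γ)
    (c : X × A → EReal) (hc : LowerSemianalytic c)
    (hreal : ∀ xa ∈ Γ, c xa ≠ ⊤ ∧ c xa ≠ ⊥)
    (hext : ∀ xa ∉ Γ, c xa = ⊤)
    (α : ℝ) (hα0 : 0 < α) (hα1 : α ≤ 1) :
    LowerSemianalytic (Rcvar c α) ∧ LowerSemianalytic (Rvar c α) := by
  have hbot : ∀ y, c y ≠ ⊥ := fun y => by
    by_cases hy : y ∈ Γ
    · exact (hreal y hy).2
    · simp [hext y hy]
  exact ⟨lowerSemianalytic_Rcvar hc hbot hα0, lowerSemianalytic_Rvar hc hbot α⟩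

end PaperStmt
end
end
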